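/- arXiv:2005.02112 — 2 statements merged into one kernel-verified Lean document; each statement's English description precedes it below -/
import Mathlib

section
/- Geodesics on the cone of positive definite matrices are convex with respect to the vectorial distance: for all symmetric positive definite p, q, r, o and all t ∈ [0,1], d⃗(p #_t q, r #_t o) ⪯ (1−t) d⃗(p,r) + t d⃗(q,o). Moreover, given the midpoint contraction property d⃗(r #_{1/2} p, r #_{1/2} q) ⪯ (1/2) d⃗(p,q), this convexity inequality for all dyadic rationals t = k/2^m follows by induction, and extends to all t ∈ [0,1] by continuity. -/
open Matrix

noncomputable section

variable {n : ℕ}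

/-- The `t`-th power of a symmetric matrix, defined via the spectral decomposition
(junk value if the matrix is not symmetric). -/
noncomputable def mpow (A : Matrix (Fin n) (Fin n) ℝ) (t : ℝ) : Matrix (Fin n) (Fin n) ℝ :=
  if h : A.IsHermitian then
    (h.eigenvectorUnitary : Matrix (Fin n) (Fin n) ℝ) *
      Matrix.diagonal (fun i => (h.eigenvalues i) ^ t) *
      (star (h.eigenvectorUnitary : Matrix (Fin n) (Fin n) ℝ))
  else A

/-- Eigenvalues of a symmetric matrix, listed in nonincreasing order
(junk value `0` if the matrix is not symmetric). -/
noncomputable def eigsDesc (A : Matrix (Fin n) (Fin n) ℝ) : Fin n → ℝ :=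
  if h : A.IsHermitian then fun i => h.eigenvalues (Tuple.sort h.eigenvalues i.rev) else 0

/-- Singular values of a square real matrix, in nonincreasing order. -/
noncomputable def svals (g : Matrix (Fin n) (Fin n) ℝ) : Fin n → ℝ :=
  fun i => Real.sqrt (eigsDesc (gᵀ * g) i)

/-- The vector `σ⃗(g)` of base-2 logarithms of the singular values of `g`,
in nonincreasing order. -/
noncomputable def sigmaVec (g : Matrix (Fin n) (Fin n) ℝ) : Fin n → ℝ :=
  fun i => Real.logb 2 (svals g i)

/-- The vectorial distance `d⃗(p,q) = 2 σ⃗(p^{-1/2} q^{1/2})`. -/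
noncomputable def vecd (p q : Matrix (Fin n) (Fin n) ℝ) : Fin n → ℝ :=
  fun i => 2 * sigmaVec (mpow p (-(1/2)) * mpow q (1/2)) i

/-- Partial sum of the first `k` components of a vector in `ℝⁿ`. -/
noncomputable def psum (ξ : Fin n → ℝ) (k : ℕ) : ℝ :=
  ∑ i ∈ Finset.univ.filter (fun i : Fin n => (i : ℕ) < k), ξ i

/-- The majorization-type partial order `⪯` on `ℝⁿ`: all partial sums are compared,
with equality of the total sums. -/
def maj (ξ η : Fin n → ℝ) : Prop :=
  (∀ k : ℕ, k < n → psum ξ k ≤ psum η k) ∧ psum ξ n = psum η n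

/-- The geodesic `p #_t q = p^{1/2} (p^{-1/2} q p^{-1/2})^t p^{1/2}` in the trace metric
on positive definite matrices. -/
noncomputable def geo (p q : Matrix (Fin n) (Fin n) ℝ) (t : ℝ) : Matrix (Fin n) (Fin n) ℝ :=
  mpow p (1/2) * mpow (mpow p (-(1/2)) * q * mpow p (-(1/2))) t * mpow p (1/2)

/-- The Riemannian (trace-metric) distance on positive definite matrices, expressed as the
Euclidean norm of the vector of base-2 logarithms of the eigenvalues of `p^{-1/2} q p^{-1/2}`. -/
noncomputable def rdist (p q : Matrix (Fin n) (Fin n) ℝ) : ℝ :=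
  Real.sqrt (∑ i : Fin n,
    (Real.logb 2 (eigsDesc (mpow p (-(1/2)) * q * mpow p (-(1/2))) i)) ^ 2)



/-- The k-th compound matrix. -/
def cmpd {n : ℕ} (k : ℕ) (A : Matrix (Fin n) (Fin n) ℝ) :
    Matrix (Set.powersetCard (Fin n) k) (Set.powersetCard (Fin n) k) ℝ :=
  LinearMap.toMatrix ((Pi.basisFun ℝ (Fin n)).exteriorPower k)
    ((Pi.basisFun ℝ (Fin n)).exteriorPower k) (exteriorPower.map k (Matrix.toLin' A))

lemma cmpd_mul {n k : ℕ} (A B : Matrix (Fin n) (Fin n) ℝ) :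
    cmpd k (A * B) = cmpd k A * cmpd k B := by
  unfold cmpd
  rw [Matrix.toLin'_mul, exteriorPower.map_comp, LinearMap.toMatrix_comp _
    ((Pi.basisFun ℝ (Fin n)).exteriorPower k)]

lemma cmpd_one {n k : ℕ} : cmpd k (1 : Matrix (Fin n) (Fin n) ℝ) = 1 := by
  unfold cmpd
  rw [Matrix.toLin'_one, exteriorPower.map_id, LinearMap.toMatrix_id]

lemma cmpd_apply {n k : ℕ} (A : Matrix (Fin n) (Fin n) ℝ) (s t : Set.powersetCard (Fin n) k) :
    cmpd k A s t = (A.submatrix (Set.powersetCard.ofFinEmbEquiv.symm s)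
      (Set.powersetCard.ofFinEmbEquiv.symm t)).det := by
  unfold cmpd
  rw [LinearMap.toMatrix_apply, exteriorPower.basis_apply, exteriorPower.map_apply_ιMulti_family,
    exteriorPower.basis_repr_apply, exteriorPower.ιMulti_family,
    exteriorPower.ιMultiDual_apply_ιMulti, ← Matrix.det_transpose]
  congr 1
  ext i j
  simp

lemma cmpd_transpose {n k : ℕ} (A : Matrix (Fin n) (Fin n) ℝ) :
    cmpd k Aᵀ = (cmpd k A)ᵀ := by
  ext s t
  rw [Matrix.transpose_apply, cmpd_apply, cmpd_apply, ← Matrix.det_transpose]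
  rfl

lemma cmpd_diagonal {n k : ℕ} (d : Fin n → ℝ) :
    cmpd k (Matrix.diagonal d) = Matrix.diagonal (fun s => ∏ i ∈ s.1, d i) := by
  ext s t
  unfold cmpd
  rw [LinearMap.toMatrix_apply, exteriorPower.basis_apply, exteriorPower.map_apply_ιMulti_family,
    exteriorPower.ιMulti_family]
  have h1 : ((⇑(toLin' (diagonal d)) ∘ ⇑(Pi.basisFun ℝ (Fin n))) ∘
      ⇑(Set.powersetCard.ofFinEmbEquiv.symm t)) = fun j =>
      d (Set.powersetCard.ofFinEmbEquiv.symm t j) •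
        ((Pi.basisFun ℝ (Fin n)) ∘ (Set.powersetCard.ofFinEmbEquiv.symm t)) j := by
    ext j i
    simp [Pi.single_apply]
  rw [h1, AlternatingMap.map_smul_univ]
  have h2 : ∏ i, d (Set.powersetCard.ofFinEmbEquiv.symm t i) = ∏ i ∈ t.1, d i := by
    have : t.1 = Finset.univ.map (Set.powersetCard.ofFinEmbEquiv.symm t).toEmbedding := by
      ext i
      have := Set.powersetCard.mem_range_ofFinEmbEquiv_symm_iff_mem t i
      simp only [Set.mem_range] at this
      simp [this]
      rfl
    rw [this, Finset.prod_map]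
    rfl
  have h3 := exteriorPower.basis_repr ℝ k (Pi.basisFun ℝ (Fin n)) t
  rw [exteriorPower.ιMulti_family] at h3
  rw [map_smul, h3, h2, Matrix.diagonal_apply, Finsupp.smul_apply, Finsupp.single_apply]
  by_cases h : s = t
  · subst h; simp
  · simp [h, Ne.symm h]


/-- Complexification of a weighted operator bound. -/
lemma cplx_bound {S : Type*} [Fintype S] (K : Matrix S S ℝ) (c d : S → ℝ) (L : ℝ)
    (h : ∀ v : S → ℝ, ∑ j, c j * (∑ i, v i * K i j)^2 ≤ L * ∑ i, d i * (v i)^2)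
    (u : S → ℂ) :
    ∑ j, c j * ‖∑ i, u i * (K i j : ℂ)‖^2 ≤ L * ∑ i, d i * ‖u i‖^2 := by
  have e1 := h (fun i => (u i).re)
  have e2 := h (fun i => (u i).im)
  have n1 : ∀ z : ℂ, ‖z‖^2 = z.re^2 + z.im^2 := by
    intro z; rw [← Complex.normSq_eq_norm_sq, Complex.normSq_apply]; ring
  simp only [n1, Complex.re_sum, Complex.im_sum, Complex.re_mul_ofReal, Complex.im_mul_ofReal,
    mul_add, Finset.sum_add_distrib]
  linarith

lemma cs_bound {S : Type*} [Fintype S] (c : S → ℝ) (w : S → ℂ) (x : S → ℝ)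
    (e : S → ℂ) (he : ∀ j, ‖e j‖^2 = c j) :
    ‖∑ j, w j * e j * (x j : ℂ)‖ ≤ √(∑ j, c j * ‖w j‖^2) * √(∑ j, (x j)^2) := by
  calc ‖∑ j, w j * e j * (x j : ℂ)‖ ≤ ∑ j, ‖w j * e j * (x j : ℂ)‖ := norm_sum_le _ _
    _ = ∑ j, ‖w j * e j‖ * |x j| := by simp
    _ ≤ √(∑ j, ‖w j * e j‖^2) * √(∑ j, |x j|^2) := Real.sum_mul_le_sqrt_mul_sqrt _ _ _
    _ = _ := by
      simp only [norm_mul, mul_pow, he, sq_abs]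
      simp only [mul_comm]

lemma core {S : Type*} [Fintype S] (K : Matrix S S ℝ) (α β : S → ℝ) (L M : ℝ)
    (h0 : ∀ v : S → ℝ, ∑ j, (∑ i, v i * K i j)^2 ≤ Real.exp L * ∑ i, (v i)^2)
    (h1 : ∀ v : S → ℝ, ∑ j, Real.exp (β j) * (∑ i, v i * K i j)^2 ≤
      Real.exp M * ∑ i, Real.exp (α i) * (v i)^2) (t : ℝ) (ht : t ∈ Set.Icc (0:ℝ) 1)
    (v : S → ℝ) :
    ∑ j, Real.exp (t * β j) * (∑ i, v i * K i j)^2 ≤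
      Real.exp ((1-t) * L + t * M) * ∑ i, Real.exp (t * α i) * (v i)^2 := by
  set y : S → ℝ := fun i => Real.exp (t / 2 * α i) * v i with hy
  set x : S → ℝ := fun j => Real.exp (t / 2 * β j) * ∑ i, v i * K i j with hx
  set X : ℝ := ∑ j, (x j)^2 with hX
  set Y : ℝ := ∑ i, (y i)^2 with hY
  have hsq : ∀ s : ℝ, Real.exp (t / 2 * s) ^ 2 = Real.exp (t * s) := by
    intro s; rw [← Real.exp_nat_mul]; congr 1; push_cast; ring
  have hX' : ∑ j, Real.exp (t * β j) * (∑ i, v i * K i j)^2 = X := by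
    simp only [hX, hx, mul_pow, hsq]
  have hY' : ∑ i, Real.exp (t * α i) * (v i)^2 = Y := by
    simp only [hY, hy, mul_pow, hsq]
  rw [hX', hY']
  have hX0 : 0 ≤ X := Finset.sum_nonneg fun _ _ => sq_nonneg _
  have hY0 : 0 ≤ Y := Finset.sum_nonneg fun _ _ => sq_nonneg _
  set u : ℂ → S → ℂ := fun z i => (y i : ℂ) * Complex.exp (-(z/2) * α i) with hu
  set F : ℂ → ℂ := fun z => ∑ j, (∑ i, u z i * (K i j : ℂ)) *
    Complex.exp ((z/2) * β j) * (x j : ℂ) with hF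
  have hdiff : Differentiable ℂ F := by
    simp only [hF, hu]
    fun_prop
  have nexp : ∀ (z : ℂ) (s : ℝ), ‖Complex.exp ((z/2) * s)‖ = Real.exp (z.re/2 * s) := by
    intro z s
    rw [Complex.norm_exp]; congr 1
    have : z / 2 * (s:ℂ) = ((s/2 : ℝ) : ℂ) * z := by push_cast; ring
    rw [this, Complex.re_ofReal_mul]; ring
  have nexp' : ∀ (z : ℂ) (s : ℝ), ‖Complex.exp (-(z/2) * s)‖ = Real.exp (-(z.re/2 * s)) := by
    intro z s
    have := nexp z (-s)
    push_cast at this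
    rw [neg_mul, ← mul_neg, this]; congr 1; ring
  have hFt : F t = (X : ℂ) := by
    have e1 : ∀ i, u t i = (v i : ℂ) := by
      intro i
      simp only [hu, hy]
      push_cast
      rw [mul_right_comm, ← Complex.exp_add]
      ring_nf
      simp
    simp only [hF, e1, hX, hx]
    push_cast
    refine Finset.sum_congr rfl fun j _ => ?_
    ring
  have hB : BddAbove ((norm ∘ F) '' Complex.HadamardThreeLines.verticalClosedStrip 0 1) := by
    set G : ℝ → ℝ := fun s => ∑ j, (∑ i, (|y i| * Real.exp (-(s/2 * α i))) * |K i j|) *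
      Real.exp (s/2 * β j) * |x j| with hG
    have hGc : Continuous G := by simp only [hG]; fun_prop
    obtain ⟨C, hC⟩ := (isCompact_Icc (a := (0:ℝ)) (b := 1)).bddAbove_image hGc.continuousOn
    refine ⟨C, ?_⟩
    rintro _ ⟨z, hz, rfl⟩
    refine le_trans ?_ (hC ⟨z.re, hz, rfl⟩)
    simp only [Function.comp, hF, hG]
    refine (norm_sum_le _ _).trans (Finset.sum_le_sum fun j _ => ?_)
    rw [norm_mul, norm_mul, nexp, Complex.norm_real, Real.norm_eq_abs]
    gcongr
    refine (norm_sum_le _ _).trans (Finset.sum_le_sum fun i _ => ?_)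
    simp only [hu]
    rw [norm_mul, norm_mul, nexp', Complex.norm_real, Complex.norm_real]
    rfl
  have b0 : ∀ z ∈ Complex.re ⁻¹' {(0:ℝ)}, ‖F z‖ ≤ √(Real.exp L * Y) * √X := by
    intro z hz
    have hz : z.re = 0 := hz
    refine (cs_bound (fun _ => 1) _ x _ ?_).trans ?_
    · intro j; rw [nexp, hz]; simp
    gcongr
    refine (cplx_bound K (fun _ => 1) (fun _ => 1) (Real.exp L) (by simpa using h0) (u z)).trans ?_
    simp only [hu, norm_mul, nexp', hz, hY]
    simp
  have b1 : ∀ z ∈ Complex.re ⁻¹' {(1:ℝ)}, ‖F z‖ ≤ √(Real.exp M * Y) * √X := by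
    intro z hz
    have hz : z.re = 1 := hz
    refine (cs_bound (fun j => Real.exp (β j)) _ x _ ?_).trans ?_
    · intro j; rw [nexp, hz, ← Real.exp_nat_mul]; congr 1; push_cast; ring
    gcongr
    refine (cplx_bound K _ _ (Real.exp M) h1 (u z)).trans ?_
    refine le_of_eq ?_
    congr 1
    refine Finset.sum_congr rfl fun i _ => ?_
    simp only [hu, norm_mul, nexp', hz, mul_pow, ← Real.exp_nat_mul]
    rw [mul_left_comm, ← Real.exp_add]
    push_cast
    ring_nf
    simp
  have key := Complex.HadamardThreeLines.norm_le_interp_of_mem_verticalClosedStrip₀₁' F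
    (z := (t : ℂ)) (by simpa [Complex.HadamardThreeLines.verticalClosedStrip] using ht)
    hdiff.diffContOnCl hB b0 b1
  rw [hFt, Complex.norm_real, Real.norm_of_nonneg hX0, Complex.ofReal_re] at key
  rcases hX0.eq_or_lt with h | hXp
  · rw [← h]; positivity
  have hr : ∀ (E : ℝ), (√(Real.exp E * Y) * √X) = Real.exp (E/2) * √(Y*X) := by
    intro E
    rw [Real.sqrt_mul (Real.exp_pos _).le, Real.sqrt_mul hY0, Real.exp_half, mul_assoc]
  rw [hr, hr, Real.mul_rpow (by positivity) (by positivity),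
    Real.mul_rpow (by positivity) (by positivity), ← Real.exp_mul, ← Real.exp_mul,
    mul_mul_mul_comm, ← Real.exp_add] at key
  have hsum : √(Y*X) ^ (1-t) * √(Y*X)^t = √(Y*X) := by
    rw [← Real.rpow_add' (by positivity) (by norm_num)]; norm_num
  rw [hsum] at key
  have k2 : X^2 ≤ (Real.exp (L/2*(1-t) + M/2*t) * √(Y*X))^2 := by gcongr
  rw [mul_pow, Real.sq_sqrt (by positivity), ← Real.exp_nat_mul] at k2
  have : ((2:ℕ):ℝ) * (L/2*(1-t) + M/2*t) = (1-t)*L + t*M := by push_cast; ring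
  rw [this, sq, ← mul_assoc] at k2
  exact le_of_mul_le_mul_right k2 hXp

lemma quad_eq {S : Type*} [Fintype S] [DecidableEq S] (g : Matrix S S ℝ) (d : S → ℝ) (w : S → ℝ) :
    w ⬝ᵥ ((g * diagonal d * gᵀ) *ᵥ w) = ∑ i, d i * ((gᵀ *ᵥ w) i)^2 := by
  rw [← Matrix.mulVec_mulVec, ← Matrix.mulVec_mulVec, Matrix.dotProduct_mulVec,
    ← Matrix.mulVec_transpose, dotProduct]
  refine Finset.sum_congr rfl fun i _ => ?_
  rw [Matrix.mulVec_diagonal]; ring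

lemma core_mat {S : Type*} [Fintype S] [DecidableEq S] (g g' h : Matrix S S ℝ) (hg : g * g' = 1)
    (α β : S → ℝ) (L M : ℝ)
    (h0 : ∀ w : S → ℝ, ∑ j, ((hᵀ *ᵥ w) j)^2 ≤ Real.exp L * ∑ i, ((gᵀ *ᵥ w) i)^2)
    (h1 : ∀ w : S → ℝ, ∑ j, Real.exp (β j) * ((hᵀ *ᵥ w) j)^2 ≤
      Real.exp M * ∑ i, Real.exp (α i) * ((gᵀ *ᵥ w) i)^2) (t : ℝ) (ht : t ∈ Set.Icc (0:ℝ) 1)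
    (w : S → ℝ) :
    ∑ j, Real.exp (t * β j) * ((hᵀ *ᵥ w) j)^2 ≤
      Real.exp ((1-t) * L + t * M) * ∑ i, Real.exp (t * α i) * ((gᵀ *ᵥ w) i)^2 := by
  have e1 : ∀ (v : S → ℝ) (j : S), ∑ i, v i * (g' * h) i j = (hᵀ *ᵥ (g'ᵀ *ᵥ v)) j := by
    intro v j
    rw [Matrix.mulVec_mulVec, ← Matrix.transpose_mul, Matrix.mulVec_transpose]
    rfl
  have e2 : ∀ v : S → ℝ, gᵀ *ᵥ (g'ᵀ *ᵥ v) = v := by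
    intro v
    rw [Matrix.mulVec_mulVec, ← Matrix.transpose_mul, mul_eq_one_comm.mp hg]
    simp
  have e3 : g'ᵀ *ᵥ (gᵀ *ᵥ w) = w := by
    rw [Matrix.mulVec_mulVec, ← Matrix.transpose_mul, hg]
    simp
  have := core (g' * h) α β L M
    (fun v => by simpa only [e1, e2] using h0 (g'ᵀ *ᵥ v))
    (fun v => by simpa only [e1, e2] using h1 (g'ᵀ *ᵥ v)) t ht (gᵀ *ᵥ w)
  simpa only [e1, e3] using this

lemma mpow_eq {n : ℕ} (A U : Matrix (Fin n) (Fin n) ℝ) (a : Fin n → ℝ) (hU : Uᵀ * U = 1)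
    (hA : A = U * diagonal a * Uᵀ) (t : ℝ) :
    mpow A t = U * diagonal (fun i => a i ^ t) * Uᵀ := by
  have hH : A.IsHermitian := by
    rw [Matrix.IsHermitian, Matrix.conjTranspose_eq_transpose_of_trivial, hA]
    simp [Matrix.transpose_mul, Matrix.mul_assoc]
  have hU' : U * Uᵀ = 1 := mul_eq_one_comm.mp hU
  rw [mpow, dif_pos hH]
  have hs := hH.spectral_theorem
  rw [Unitary.conjStarAlgAut_apply] at hs
  set V : Matrix (Fin n) (Fin n) ℝ := (hH.eigenvectorUnitary : Matrix (Fin n) (Fin n) ℝ) with hV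
  have hVs : star V = Vᵀ := by
    rw [Matrix.star_eq_conjTranspose, Matrix.conjTranspose_eq_transpose_of_trivial]
  have hV1 : Vᵀ * V = 1 := by rw [← hVs]; exact Unitary.coe_star_mul_self _
  have hV2 : V * Vᵀ = 1 := mul_eq_one_comm.mp hV1
  rw [hVs] at hs ⊢
  set b := hH.eigenvalues with hb
  have hs' : A = V * diagonal b * Vᵀ := hs
  have hW : diagonal a * (Uᵀ * V) = (Uᵀ * V) * diagonal b := by
    calc diagonal a * (Uᵀ * V) = (Uᵀ * U) * diagonal a * Uᵀ * V := by
          rw [hU]; simp [Matrix.mul_assoc]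
      _ = Uᵀ * A * V := by rw [hA]; simp only [Matrix.mul_assoc]
      _ = Uᵀ * V * diagonal b * (Vᵀ * V) := by rw [hs']; simp only [Matrix.mul_assoc]
      _ = _ := by rw [hV1, Matrix.mul_one]
  have hW' : diagonal (fun i => a i ^ t) * (Uᵀ * V) = (Uᵀ * V) * diagonal (fun i => b i ^ t) := by
    ext i j
    have h := congrFun (congrFun hW i) j
    rw [Matrix.diagonal_mul, Matrix.mul_diagonal] at h ⊢
    by_cases h0 : (Uᵀ * V) i j = 0
    · simp [h0]
    · have : a i = b j := mul_right_cancel₀ h0 (by rw [h, mul_comm])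
      rw [this, mul_comm]
  calc V * diagonal (fun i => b i ^ t) * Vᵀ
      = U * (Uᵀ * V * diagonal (fun i => b i ^ t)) * Vᵀ := by
        rw [← Matrix.mul_assoc, ← Matrix.mul_assoc, hU', Matrix.one_mul]
    _ = U * diagonal (fun i => a i ^ t) * Uᵀ * (V * Vᵀ) := by
        rw [← hW']; simp only [Matrix.mul_assoc]
    _ = _ := by rw [hV2, Matrix.mul_one]

lemma posdef_diag {n : ℕ} {A : Matrix (Fin n) (Fin n) ℝ} (hA : A.PosDef) :
    ∃ U : Matrix (Fin n) (Fin n) ℝ, Uᵀ * U = 1 ∧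
      A = U * diagonal (hA.isHermitian.eigenvalues) * Uᵀ := by
  have hs := hA.isHermitian.spectral_theorem
  rw [Unitary.conjStarAlgAut_apply] at hs
  set V : Matrix (Fin n) (Fin n) ℝ :=
    (hA.isHermitian.eigenvectorUnitary : Matrix (Fin n) (Fin n) ℝ) with hV
  have hVs : star V = Vᵀ := by
    rw [Matrix.star_eq_conjTranspose, Matrix.conjTranspose_eq_transpose_of_trivial]
  refine ⟨V, ?_, ?_⟩
  · rw [← hVs]; exact Unitary.coe_star_mul_self _
  · rw [hVs] at hs; exact hs

lemma half_pow {n : ℕ} {p : Matrix (Fin n) (Fin n) ℝ} (hp : p.PosDef) :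
    (mpow p (1/2))ᵀ = mpow p (1/2) ∧ (mpow p (-(1/2)))ᵀ = mpow p (-(1/2)) ∧
    mpow p (1/2) * mpow p (1/2) = p ∧ mpow p (1/2) * mpow p (-(1/2)) = 1 ∧
    mpow p (-(1/2)) * mpow p (1/2) = 1 := by
  obtain ⟨U, hU, hA⟩ := posdef_diag hp
  have hpos := hp.eigenvalues_pos
  set a := hp.isHermitian.eigenvalues
  have hU' : U * Uᵀ = 1 := mul_eq_one_comm.mp hU
  rw [mpow_eq p U a hU hA, mpow_eq p U a hU hA]
  have hm : ∀ d e : Fin n → ℝ, U * diagonal d * Uᵀ * (U * diagonal e * Uᵀ) =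
      U * diagonal (fun i => d i * e i) * Uᵀ := by
    intro d e
    rw [← Matrix.diagonal_mul_diagonal]
    calc _ = U * diagonal d * (Uᵀ * U) * diagonal e * Uᵀ := by simp only [Matrix.mul_assoc]
      _ = _ := by rw [hU]; simp only [Matrix.mul_assoc, Matrix.mul_one, Matrix.one_mul]
  have h1 : ∀ d : Fin n → ℝ, (∀ i, d i = 1) → U * diagonal d * Uᵀ = 1 := by
    intro d hd
    have : d = fun _ => 1 := funext hd
    rw [this, Matrix.diagonal_one, Matrix.mul_one, hU']
  refine ⟨?_, ?_, ?_, ?_, ?_⟩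
  · simp [Matrix.transpose_mul, Matrix.mul_assoc]
  · simp [Matrix.transpose_mul, Matrix.mul_assoc]
  · rw [hm]
    conv_rhs => rw [hA]
    congr 3
    ext i
    rw [← Real.rpow_add (hpos i)]; norm_num
  · rw [hm]; refine h1 _ fun i => ?_
    rw [← Real.rpow_add (hpos i)]; norm_num
  · rw [hm]; refine h1 _ fun i => ?_
    rw [← Real.rpow_add (hpos i)]; norm_num

lemma posdef_of_gram {n : ℕ} (g g' : Matrix (Fin n) (Fin n) ℝ) (hg : g * g' = 1) :
    (g * gᵀ).PosDef := by
  have h := Matrix.PosDef.one (n := Fin n) (R := ℝ)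
  have hu : IsUnit g := ⟨⟨g, g', hg, mul_eq_one_comm.mp hg⟩, rfl⟩
  have := (hu.posDef_star_right_conjugate_iff (x := 1)).mpr h
  simpa [Matrix.star_eq_conjTranspose, Matrix.conjTranspose_eq_transpose_of_trivial] using this

lemma geo_form {n : ℕ} {p q : Matrix (Fin n) (Fin n) ℝ} (hp : p.PosDef) (hq : q.PosDef) :
    ∃ (g g' : Matrix (Fin n) (Fin n) ℝ) (α : Fin n → ℝ), g * g' = 1 ∧ p = g * gᵀ ∧
      q = g * diagonal (fun i => Real.exp (α i)) * gᵀ ∧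
      ∀ t, geo p q t = g * diagonal (fun i => Real.exp (t * α i)) * gᵀ := by
  obtain ⟨s1, s2, s3, s4, s5⟩ := half_pow hp
  obtain ⟨q1, q2, q3, q4, q5⟩ := half_pow hq
  set s := mpow p (1/2) with hs
  set s' := mpow p (-(1/2)) with hs'
  set c := mpow q (1/2)
  set c' := mpow q (-(1/2))
  have hM : (s' * q * s').PosDef := by
    have : s' * q * s' = (s' * c) * (s' * c)ᵀ := by
      rw [Matrix.transpose_mul, q1, s2, ← q3]; simp only [Matrix.mul_assoc]
    rw [this]
    refine posdef_of_gram _ (c' * s) ?_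
    calc _ = s' * (c * c') * s := by simp only [Matrix.mul_assoc]
      _ = 1 := by rw [q4, Matrix.mul_one, s5]
  obtain ⟨V, hV, hA⟩ := posdef_diag hM
  have hpos := hM.eigenvalues_pos
  set a := hM.isHermitian.eigenvalues
  have hV' : V * Vᵀ = 1 := mul_eq_one_comm.mp hV
  refine ⟨s * V, Vᵀ * s', fun i => Real.log (a i), ?_, ?_, ?_, ?_⟩
  · calc _ = s * (V * Vᵀ) * s' := by simp only [Matrix.mul_assoc]
      _ = 1 := by rw [hV', Matrix.mul_one, s4]
  · rw [Matrix.transpose_mul, s1]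
    calc p = s * s := s3.symm
      _ = s * (V * Vᵀ) * s := by rw [hV', Matrix.mul_one]
      _ = _ := by simp only [Matrix.mul_assoc]
  · have : (fun i => Real.exp (Real.log (a i))) = a := funext fun i => Real.exp_log (hpos i)
    rw [this, Matrix.transpose_mul, s1]
    calc q = (s * s') * q * (s' * s) := by rw [s4, s5, Matrix.one_mul, Matrix.mul_one]
      _ = s * (s' * q * s') * s := by simp only [Matrix.mul_assoc]
      _ = _ := by rw [hA]; simp only [Matrix.mul_assoc]
  · intro t
    rw [geo, mpow_eq _ V a hV hA, Matrix.transpose_mul, ← hs, s1]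
    have : (fun i => a i ^ t) = fun i => Real.exp (t * Real.log (a i)) :=
      funext fun i => by rw [Real.rpow_def_of_pos (hpos i), mul_comm]
    rw [this]
    simp only [Matrix.mul_assoc]

lemma geo_posdef {n : ℕ} {p q : Matrix (Fin n) (Fin n) ℝ} (hp : p.PosDef) (hq : q.PosDef)
    (t : ℝ) : (geo p q t).PosDef := by
  obtain ⟨g, g', α, hg, -, -, h⟩ := geo_form hp hq
  have hd : ∀ x y : ℝ, x + y = t → (diagonal fun i => Real.exp (x * α i)) *
      (diagonal fun i => Real.exp (y * α i)) = diagonal fun i => Real.exp (t * α i) := by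
    intro x y h
    rw [Matrix.diagonal_mul_diagonal]
    simp only [← Real.exp_add, ← add_mul, h]
  have : geo p q t = (g * diagonal (fun i => Real.exp (t / 2 * α i))) *
      (g * diagonal (fun i => Real.exp (t / 2 * α i)))ᵀ := by
    rw [h, Matrix.transpose_mul, Matrix.diagonal_transpose, ← hd (t/2) (t/2) (by ring)]
    simp only [Matrix.mul_assoc]
  rw [this]
  refine posdef_of_gram _ (diagonal (fun i => Real.exp (-(t / 2 * α i))) * g') ?_
  calc _ = g * (diagonal (fun i => Real.exp (t / 2 * α i)) *
        diagonal (fun i => Real.exp (-(t / 2 * α i)))) * g' := by simp only [Matrix.mul_assoc]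
    _ = 1 := by
      rw [Matrix.diagonal_mul_diagonal]
      simp [← Real.exp_add, hg]

lemma vecd_form {n : ℕ} {p r : Matrix (Fin n) (Fin n) ℝ} (hp : p.PosDef) (hr : r.PosDef) :
    ∃ (G G' : Matrix (Fin n) (Fin n) ℝ), G * G' = 1 ∧ p = G * Gᵀ ∧
      r = G * diagonal (fun i => Real.exp (Real.log 2 * vecd p r i)) * Gᵀ ∧
      Antitone (vecd p r) := by
  obtain ⟨s1, s2, s3, s4, s5⟩ := half_pow hp
  obtain ⟨q1, q2, q3, q4, q5⟩ := half_pow hr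
  set s := mpow p (1/2) with hs
  set s' := mpow p (-(1/2)) with hs'
  set c := mpow r (1/2) with hc
  set c' := mpow r (-(1/2))
  set g := s' * c with hg
  have hgT : gᵀ = c * s' := by rw [hg, Matrix.transpose_mul, q1, s2]
  have hM : (gᵀ * g).PosDef := by
    have : gᵀ * g = gᵀ * (gᵀ)ᵀ := by rw [Matrix.transpose_transpose]
    rw [this]
    refine posdef_of_gram _ (s * c') ?_
    rw [hgT]
    calc _ = c * (s' * s) * c' := by simp only [Matrix.mul_assoc]
      _ = 1 := by rw [s5, Matrix.mul_one, q4]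
  obtain ⟨V, hV, hA⟩ := posdef_diag hM
  have hpos := hM.eigenvalues_pos
  have hE : eigsDesc (gᵀ * g) = fun i => hM.isHermitian.eigenvalues
      (Tuple.sort hM.isHermitian.eigenvalues i.rev) := by
    rw [eigsDesc, dif_pos hM.isHermitian]
  set a := hM.isHermitian.eigenvalues
  set e := eigsDesc (gᵀ * g) with he
  have hepos : ∀ i, 0 < e i := fun i => by rw [hE]; exact hpos _
  have heanti : Antitone e := by
    intro i j hij
    rw [hE]
    exact Tuple.monotone_sort a (Fin.rev_le_rev.mpr hij)
  have hvec : ∀ i, vecd p r i = Real.log (e i) / Real.log 2 := by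
    intro i
    simp only [vecd, sigmaVec, svals, ← hs', ← hc, ← hg, ← he]
    rw [Real.logb, Real.log_sqrt (hepos i).le]; ring
  have hl2 : 0 < Real.log 2 := Real.log_pos (by norm_num)
  have hexp : (fun i => Real.exp (Real.log 2 * vecd p r i)) = e := by
    funext i
    rw [hvec, mul_div_cancel₀ _ hl2.ne', Real.exp_log (hepos i)]
  rw [hexp]
  let σ : Fin n ≃ Fin n := Fin.revPerm.trans (Tuple.sort a)
  set W := V.submatrix id σ with hW
  have hWW : Wᵀ * W = 1 := by
    rw [hW, Matrix.transpose_submatrix, ← Matrix.submatrix_mul _ _ σ id σ Function.bijective_id, hV,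
      Matrix.submatrix_one_equiv]
  have hWW' : W * Wᵀ = 1 := mul_eq_one_comm.mp hWW
  have hAW : gᵀ * g = W * diagonal e * Wᵀ := by
    have hde : diagonal e = (diagonal a).submatrix σ σ := by
      rw [Matrix.submatrix_diagonal_equiv, hE]; rfl
    rw [hA, hW, hde, Matrix.transpose_submatrix,
      Matrix.submatrix_mul_equiv, Matrix.submatrix_mul_equiv, Matrix.submatrix_id_id]
  set D := diagonal (fun i => √(e i)) with hD
  set D' := diagonal (fun i => (√(e i))⁻¹) with hD'
  have hDD : D * D' = 1 := by
    rw [hD, hD', Matrix.diagonal_mul_diagonal, ← Matrix.diagonal_one]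
    congr 1; funext i
    exact mul_inv_cancel₀ (Real.sqrt_pos.mpr (hepos i)).ne'
  have hDD' : D' * D = 1 := mul_eq_one_comm.mp hDD
  have hDe : D * D = diagonal e := by
    rw [hD, Matrix.diagonal_mul_diagonal]
    congr 1; funext i
    exact Real.mul_self_sqrt (hepos i).le
  have hDT : Dᵀ = D := Matrix.diagonal_transpose _
  have hDT' : D'ᵀ = D' := Matrix.diagonal_transpose _
  set Q := g * W * D' with hQ
  have hQQ : Qᵀ * Q = 1 := by
    rw [hQ, Matrix.transpose_mul, Matrix.transpose_mul, hDT']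
    calc _ = D' * (Wᵀ * (gᵀ * g) * W) * D' := by simp only [Matrix.mul_assoc]
      _ = D' * ((Wᵀ * W) * diagonal e * (Wᵀ * W)) * D' := by
        rw [hAW]; simp only [Matrix.mul_assoc]
      _ = (D' * D) * (D * D') := by
        rw [hWW, Matrix.one_mul, Matrix.mul_one, ← hDe]; simp only [Matrix.mul_assoc]
      _ = 1 := by rw [hDD, hDD', Matrix.one_mul]
  have hQQ' : Q * Qᵀ = 1 := mul_eq_one_comm.mp hQQ
  have hQD : Q * D = g * W := by rw [hQ, Matrix.mul_assoc, hDD', Matrix.mul_one]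
  have hQD' : D * Qᵀ = Wᵀ * gᵀ := by
    rw [← Matrix.transpose_mul, ← hQD, Matrix.transpose_mul Q D, hDT]
  refine ⟨s * Q, Qᵀ * s', ?_, ?_, ?_, ?_⟩
  · calc _ = s * (Q * Qᵀ) * s' := by simp only [Matrix.mul_assoc]
      _ = 1 := by rw [hQQ', Matrix.mul_one, s4]
  · rw [Matrix.transpose_mul, s1]
    calc p = s * s := s3.symm
      _ = s * (Q * Qᵀ) * s := by rw [hQQ', Matrix.mul_one]
      _ = _ := by simp only [Matrix.mul_assoc]
  · rw [Matrix.transpose_mul, s1, ← hDe]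
    symm
    calc _ = s * (Q * D) * (D * Qᵀ) * s := by simp only [Matrix.mul_assoc]
      _ = s * g * (W * Wᵀ) * gᵀ * s := by rw [hQD, hQD']; simp only [Matrix.mul_assoc]
      _ = (s * s') * (c * c) * (s' * s) := by
        rw [hWW', Matrix.mul_one, hgT, hg]; simp only [Matrix.mul_assoc]
      _ = r := by rw [s4, s5, q3, Matrix.one_mul, Matrix.mul_one]
  · intro i j hij
    rw [hvec, hvec]
    gcongr
    · exact hepos j
    · exact heanti hij

/-- The first `k` indices. -/
def firstK {n k : ℕ} (hk : k ≤ n) : Set.powersetCard (Fin n) k :=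
  ⟨Finset.univ.filter (fun i : Fin n => (i : ℕ) < k), by
    have h : (Finset.univ.filter (fun i : Fin n => (i : ℕ) < k)).card = k := by
      rw [Fin.card_filter_val_lt]; exact min_eq_right hk
    exact h⟩

lemma sum_le_first {n k : ℕ} (ξ : Fin n → ℝ) (hξ : Antitone ξ)
    (s : Set.powersetCard (Fin n) k) : ∑ i ∈ s.1, ξ i ≤ psum ξ k := by
  classical
  have hs : s.1.card = k := s.2
  have hkn : k ≤ n := by rw [← hs]; simpa using Finset.card_le_univ s.1
  set T := Finset.univ.filter (fun i : Fin n => (i : ℕ) < k) with hT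
  have hTc : T.card = k := (firstK hkn).2
  unfold psum
  rw [← hT]
  rcases Nat.eq_zero_or_pos k with h0 | h0
  · subst h0
    rw [Finset.card_eq_zero.mp hs, Finset.card_eq_zero.mp hTc]
  let c : Fin n := ⟨k - 1, by omega⟩
  have hcard : (s.1 \ T).card = (T \ s.1).card := by
    have e1 := Finset.card_sdiff_add_card_inter s.1 T
    have e2 := Finset.card_sdiff_add_card_inter T s.1
    rw [Finset.inter_comm] at e2
    omega
  have b1 : ∑ i ∈ s.1 \ T, ξ i ≤ (s.1 \ T).card • ξ c := by
    refine Finset.sum_le_card_nsmul _ _ _ fun i hi => hξ ?_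
    simp only [hT, Finset.mem_sdiff, Finset.mem_filter, Finset.mem_univ, true_and] at hi
    rw [Fin.le_def]; simp only [c]; omega
  have b2 : (T \ s.1).card • ξ c ≤ ∑ i ∈ T \ s.1, ξ i := by
    refine Finset.card_nsmul_le_sum _ _ _ fun i hi => hξ ?_
    simp only [hT, Finset.mem_sdiff, Finset.mem_filter, Finset.mem_univ, true_and] at hi
    rw [Fin.le_def]; simp only [c]; omega
  have e1 := Finset.sum_inter_add_sum_sdiff s.1 T ξ
  have e2 := Finset.sum_inter_add_sum_sdiff T s.1 ξ
  rw [Finset.inter_comm] at e2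
  rw [hcard] at b1
  linarith

lemma cmpd_form {n k : ℕ} (g : Matrix (Fin n) (Fin n) ℝ) (δ : Fin n → ℝ) :
    cmpd k (g * diagonal (fun i => Real.exp (δ i)) * gᵀ) =
      cmpd k g * diagonal (fun s : Set.powersetCard (Fin n) k =>
        Real.exp (∑ i ∈ s.1, δ i)) * (cmpd k g)ᵀ := by
  rw [cmpd_mul, cmpd_mul, cmpd_transpose, cmpd_diagonal]
  simp only [Real.exp_sum]

lemma cmpd_form0 {n k : ℕ} (g : Matrix (Fin n) (Fin n) ℝ) (w : Set.powersetCard (Fin n) k → ℝ) :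
    w ⬝ᵥ (cmpd k (g * gᵀ) *ᵥ w) = ∑ i, (((cmpd k g)ᵀ *ᵥ w) i)^2 := by
  have := quad_eq (cmpd k g) (fun _ => 1) w
  rw [Matrix.diagonal_one, Matrix.mul_one, ← cmpd_transpose, ← cmpd_mul] at this
  rw [this, cmpd_transpose]
  simp

lemma psum_upper {n k : ℕ} {p r : Matrix (Fin n) (Fin n) ℝ} (hp : p.PosDef) (hr : r.PosDef)
    (w : Set.powersetCard (Fin n) k → ℝ) :
    w ⬝ᵥ (cmpd k r *ᵥ w) ≤ Real.exp (Real.log 2 * psum (vecd p r) k) *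
      w ⬝ᵥ (cmpd k p *ᵥ w) := by
  obtain ⟨G, G', hG, h1, h2, h3⟩ := vecd_form hp hr
  have e1 : w ⬝ᵥ (cmpd k r *ᵥ w) = ∑ s, Real.exp (∑ i ∈ s.1, Real.log 2 * vecd p r i) *
      (((cmpd k G)ᵀ *ᵥ w) s)^2 := by
    conv_lhs => rw [h2]
    rw [cmpd_form, quad_eq]
  have e2 : w ⬝ᵥ (cmpd k p *ᵥ w) = ∑ s, (((cmpd k G)ᵀ *ᵥ w) s)^2 := by
    conv_lhs => rw [h1]
    rw [cmpd_form0]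
  rw [e1, e2, Finset.mul_sum]
  refine Finset.sum_le_sum fun s _ => ?_
  have hl2 : 0 < Real.log 2 := Real.log_pos (by norm_num)
  rw [← Finset.mul_sum]
  gcongr
  exact sum_le_first _ h3 s

lemma psum_lower {n k : ℕ} (hk : k ≤ n) {p r : Matrix (Fin n) (Fin n) ℝ} (hp : p.PosDef)
    (hr : r.PosDef) (L : ℝ)
    (h : ∀ w : Set.powersetCard (Fin n) k → ℝ, w ⬝ᵥ (cmpd k r *ᵥ w) ≤
      Real.exp L * w ⬝ᵥ (cmpd k p *ᵥ w)) :
    Real.log 2 * psum (vecd p r) k ≤ L := by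
  obtain ⟨G, G', hG, h1, h2, h3⟩ := vecd_form hp hr
  have key := h ((cmpd k G')ᵀ *ᵥ Pi.single (firstK hk) 1)
  set w := (cmpd k G')ᵀ *ᵥ Pi.single (firstK hk) (1:ℝ) with hw
  have hv : (cmpd k G)ᵀ *ᵥ w = Pi.single (firstK hk) (1:ℝ) := by
    rw [hw, Matrix.mulVec_mulVec, ← Matrix.transpose_mul, ← cmpd_mul, mul_eq_one_comm.mp hG,
      cmpd_one, Matrix.transpose_one, Matrix.one_mulVec]
  have e1 : w ⬝ᵥ (cmpd k r *ᵥ w) = ∑ s, Real.exp (∑ i ∈ s.1, Real.log 2 * vecd p r i) *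
      (((cmpd k G)ᵀ *ᵥ w) s)^2 := by
    conv_lhs => rw [h2]
    rw [cmpd_form, quad_eq]
  have e2 : w ⬝ᵥ (cmpd k p *ᵥ w) = ∑ s, (((cmpd k G)ᵀ *ᵥ w) s)^2 := by
    conv_lhs => rw [h1]
    rw [cmpd_form0]
  rw [e1, e2, hv] at key
  simp only [Pi.single_apply, ite_pow, one_pow, ne_eq, OfNat.ofNat_ne_zero, not_false_eq_true,
    zero_pow, mul_ite, mul_one, mul_zero, Finset.sum_ite_eq', Finset.mem_univ, if_true,
    Real.exp_le_exp] at key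
  rw [← Finset.mul_sum] at key
  exact key

lemma psum_total {n : ℕ} {p r : Matrix (Fin n) (Fin n) ℝ} (hp : p.PosDef) (hr : r.PosDef) :
    Real.log 2 * psum (vecd p r) n = Real.log r.det - Real.log p.det := by
  obtain ⟨G, G', hG, h1, h2, h3⟩ := vecd_form hp hr
  have hdet : r.det = p.det * Real.exp (Real.log 2 * psum (vecd p r) n) := by
    have hpd : p.det = G.det * G.det := by
      conv_lhs => rw [h1]
      rw [Matrix.det_mul, Matrix.det_transpose]
    rw [hpd]
    conv_lhs => rw [h2]
    simp only [Matrix.det_mul, Matrix.det_transpose, Matrix.det_diagonal, ← Real.exp_sum,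
      ← Finset.mul_sum, psum]
    simp
    ring
  rw [hdet, Real.log_mul hp.det_pos.ne' (Real.exp_pos _).ne', Real.log_exp]
  ring

lemma geo_det {n : ℕ} {p q : Matrix (Fin n) (Fin n) ℝ} (hp : p.PosDef) (hq : q.PosDef) (t : ℝ) :
    Real.log (geo p q t).det = (1 - t) * Real.log p.det + t * Real.log q.det := by
  obtain ⟨g, g', α, hg, h1, h2, h3⟩ := geo_form hp hq
  have hq' : q.det = p.det * Real.exp (∑ i, α i) := by
    conv_lhs => rw [h2]
    conv_rhs => rw [h1]
    simp only [Matrix.det_mul, Matrix.det_transpose, Matrix.det_diagonal, ← Real.exp_sum]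
    ring
  have ht' : (geo p q t).det = p.det * Real.exp (t * ∑ i, α i) := by
    rw [h3]
    conv_rhs => rw [h1]
    simp only [Matrix.det_mul, Matrix.det_transpose, Matrix.det_diagonal, ← Real.exp_sum,
      Finset.mul_sum]
    ring
  rw [ht', hq', Real.log_mul hp.det_pos.ne' (Real.exp_pos _).ne', Real.log_exp,
    Real.log_mul hp.det_pos.ne' (Real.exp_pos _).ne', Real.log_exp]
  ring

lemma psum_comb {n : ℕ} (ξ η : Fin n → ℝ) (a b : ℝ) (k : ℕ) :
    psum (fun i => a * ξ i + b * η i) k = a * psum ξ k + b * psum η k := by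
  simp only [psum, Finset.sum_add_distrib, Finset.mul_sum]

/-- Convexity of geodesics with respect to the vectorial distance:
`d⃗(p #_t q, r #_t o) ⪯ (1−t) d⃗(p,r) + t d⃗(q,o)` for all `t ∈ [0,1]`. -/
theorem statement10 {n : ℕ} (p q r o : Matrix (Fin n) (Fin n) ℝ)
    (hp : p.PosDef) (hq : q.PosDef) (hr : r.PosDef) (ho : o.PosDef)
    (t : ℝ) (ht : t ∈ Set.Icc (0:ℝ) 1) :
    maj (vecd (geo p q t) (geo r o t))
      (fun i => (1 - t) * vecd p r i + t * vecd q o i) := by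
  have hl2 : 0 < Real.log 2 := Real.log_pos (by norm_num)
  have hP := geo_posdef hp hq t
  have hR := geo_posdef hr ho t
  constructor
  · intro k hk
    rw [psum_comb]
    refine le_of_mul_le_mul_left ?_ hl2
    have e : Real.log 2 * ((1 - t) * psum (vecd p r) k + t * psum (vecd q o) k) =
        (1 - t) * (Real.log 2 * psum (vecd p r) k) + t * (Real.log 2 * psum (vecd q o) k) := by
      ring
    rw [e]
    refine psum_lower hk.le hP hR _ fun w => ?_
    have b0 := psum_upper (k := k) hp hr
    have b1 := psum_upper (k := k) hq ho
    obtain ⟨g, g', α, hg, g1, g2, g3⟩ := geo_form hp hq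
    obtain ⟨h, h', β, hh, h1, h2, h3⟩ := geo_form hr ho
    set L := Real.log 2 * psum (vecd p r) k
    set M := Real.log 2 * psum (vecd q o) k
    have key := core_mat (cmpd k g) (cmpd k g') (cmpd k h) (by rw [← cmpd_mul, hg, cmpd_one])
      (fun s => ∑ i ∈ s.1, α i) (fun s => ∑ i ∈ s.1, β i) L M
      (fun w => by
        have := b0 w
        rwa [g1, h1, cmpd_form0, cmpd_form0] at this)
      (fun w => by
        have := b1 w
        rwa [g2, h2, cmpd_form, cmpd_form, quad_eq, quad_eq] at this) t ht w
    rw [g3, h3, cmpd_form, cmpd_form, quad_eq, quad_eq]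
    simpa only [Finset.mul_sum] using key
  · rw [psum_comb]
    refine mul_left_cancel₀ hl2.ne' ?_
    have e1 := psum_total hp hr
    have e2 := psum_total hq ho
    rw [psum_total hP hR, geo_det hp hq, geo_det hr ho, mul_add, mul_left_comm, e1,
      mul_left_comm (Real.log 2) t, e2]
    ring
end
end

section
/- Let p₁,…,p_{m−1}, pₘ, pₘ′ be symmetric positive definite matrices and ω ∈ Δₘ a weight vector. Let u = bar(ω; p₁,…,p_{m−1},pₘ) and v = bar(ω; p₁,…,p_{m−1},pₘ′) be the corresponding weighted barycenters in the trace metric. Then d⃗(u,v) ⪯ ωₘ d⃗(pₘ, pₘ′): the barycenter is Lipschitz in each argument with constant equal to that argument's weight, with respect to the vectorial distance and the majorization order. -/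
open Matrix

noncomputable section

variable {n : ℕ}

/-! ### Spectral basics -/

lemma eigsDesc_congr {A B : Matrix (Fin n) (Fin n) ℝ} (hA : A.IsHermitian) (hB : B.IsHermitian)
    (h : A.charpoly = B.charpoly) : eigsDesc A = eigsDesc B := by
  have := (hA.eigenvalues_eq_eigenvalues_iff hB).2 h
  unfold eigsDesc
  rw [dif_pos hA, dif_pos hB, this]

lemma spec_eig {A : Matrix (Fin n) (Fin n) ℝ} (hA : A.IsHermitian) :
    A = (hA.eigenvectorUnitary : Matrix (Fin n) (Fin n) ℝ) * Matrix.diagonal hA.eigenvalues *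
      (hA.eigenvectorUnitary : Matrix (Fin n) (Fin n) ℝ)ᵀ := by
  conv_lhs => rw [hA.spectral_theorem, Unitary.conjStarAlgAut_apply]
  rfl

lemma eigU_left {A : Matrix (Fin n) (Fin n) ℝ} (hA : A.IsHermitian) :
    (hA.eigenvectorUnitary : Matrix (Fin n) (Fin n) ℝ)ᵀ * hA.eigenvectorUnitary = 1 := by
  have := Unitary.coe_star_mul_self hA.eigenvectorUnitary
  simpa [star_eq_conjTranspose] using this

lemma eigsDesc_antitone (A : Matrix (Fin n) (Fin n) ℝ) : Antitone (eigsDesc A) := by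
  unfold eigsDesc
  split_ifs with h
  · intro i j hij
    exact Tuple.monotone_sort h.eigenvalues (Fin.rev_le_rev.2 hij)
  · intro i j _; simp

lemma sum_eigsDesc {A : Matrix (Fin n) (Fin n) ℝ} (hA : A.IsHermitian) (f : ℝ → ℝ) :
    ∑ i, f (eigsDesc A i) = ∑ i, f (hA.eigenvalues i) := by
  unfold eigsDesc
  rw [dif_pos hA]
  exact Equiv.sum_comp (Fin.revPerm.trans (Tuple.sort hA.eigenvalues)) (fun i => f (hA.eigenvalues i))

lemma eigsDesc_pos {A : Matrix (Fin n) (Fin n) ℝ} (hA : A.PosDef) (i : Fin n) :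
    0 < eigsDesc A i := by
  unfold eigsDesc
  rw [dif_pos hA.1]
  exact hA.eigenvalues_pos _

lemma spec_desc {A : Matrix (Fin n) (Fin n) ℝ} (hA : A.IsHermitian) :
    ∃ O : Matrix (Fin n) (Fin n) ℝ, Oᵀ * O = 1 ∧ O * Oᵀ = 1 ∧
      A = O * Matrix.diagonal (eigsDesc A) * Oᵀ := by
  set U := (hA.eigenvectorUnitary : Matrix (Fin n) (Fin n) ℝ) with hU
  set e : Equiv.Perm (Fin n) := Fin.revPerm.trans (Tuple.sort hA.eigenvalues) with he
  have h1 : (U.submatrix id e)ᵀ * U.submatrix id e = 1 := by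
    rw [transpose_submatrix, ← submatrix_mul Uᵀ U e id e Function.bijective_id, eigU_left hA]
    simp
  refine ⟨U.submatrix id e, h1, mul_eq_one_comm.1 h1, ?_⟩
  have h2 : Matrix.diagonal (eigsDesc A) = (Matrix.diagonal hA.eigenvalues).submatrix e e := by
    rw [submatrix_diagonal_equiv]
    congr 1
    unfold eigsDesc
    rw [dif_pos hA]
    rfl
  rw [h2, transpose_submatrix, submatrix_mul_equiv, submatrix_mul_equiv]
  simpa using spec_eig hA

/-! ### Square roots -/

lemma mpow_spec {p : Matrix (Fin n) (Fin n) ℝ} (hp : p.PosDef) (s t : ℝ) :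
    mpow p s * mpow p t = mpow p (s + t) := by
  have hl := eigU_left hp.1
  unfold mpow
  rw [dif_pos hp.1, dif_pos hp.1, dif_pos hp.1]
  simp only [star_eq_conjTranspose, conjTranspose_eq_transpose_of_trivial]
  set U := (hp.1.eigenvectorUnitary : Matrix (Fin n) (Fin n) ℝ) with hU
  calc _ = U * (diagonal (fun i => hp.1.eigenvalues i ^ s) * (Uᵀ * U) *
        diagonal (fun i => hp.1.eigenvalues i ^ t)) * Uᵀ := by simp only [mul_assoc]
    _ = _ := by
      rw [hl, mul_one, diagonal_mul_diagonal]
      congr 3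
      ext i
      rw [Real.rpow_add (hp.eigenvalues_pos i)]

lemma mpow_zero' {p : Matrix (Fin n) (Fin n) ℝ} (hp : p.PosDef) : mpow p 0 = 1 := by
  have hl := mul_eq_one_comm.1 (eigU_left hp.1)
  unfold mpow
  rw [dif_pos hp.1]
  simp only [star_eq_conjTranspose, conjTranspose_eq_transpose_of_trivial, Real.rpow_zero,
    diagonal_one, mul_one, hl]

lemma mpow_one' {p : Matrix (Fin n) (Fin n) ℝ} (hp : p.PosDef) : mpow p 1 = p := by
  conv_rhs => rw [spec_eig hp.1]
  unfold mpow
  rw [dif_pos hp.1]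
  simp only [star_eq_conjTranspose, conjTranspose_eq_transpose_of_trivial, Real.rpow_one]

lemma mpow_symm {p : Matrix (Fin n) (Fin n) ℝ} (hp : p.PosDef) (t : ℝ) :
    (mpow p t)ᵀ = mpow p t := by
  unfold mpow
  rw [dif_pos hp.1]
  simp only [star_eq_conjTranspose, conjTranspose_eq_transpose_of_trivial]
  simp [transpose_mul, mul_assoc]

lemma sqrt_sq {p : Matrix (Fin n) (Fin n) ℝ} (hp : p.PosDef) :
    mpow p (1/2) * mpow p (1/2) = p := by
  rw [mpow_spec hp]; norm_num [mpow_one' hp]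

lemma isqrt_sqrt {p : Matrix (Fin n) (Fin n) ℝ} (hp : p.PosDef) :
    mpow p (-(1/2)) * mpow p (1/2) = 1 := by
  rw [mpow_spec hp]; norm_num [mpow_zero' hp]

lemma sqrt_isqrt {p : Matrix (Fin n) (Fin n) ℝ} (hp : p.PosDef) :
    mpow p (1/2) * mpow p (-(1/2)) = 1 := mul_eq_one_comm.1 (isqrt_sqrt hp)

lemma isqrt_sq {p : Matrix (Fin n) (Fin n) ℝ} (hp : p.PosDef) :
    mpow p (-(1/2)) * mpow p (-(1/2)) = p⁻¹ := by
  symm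
  apply Matrix.inv_eq_left_inv
  calc _ = mpow p (-(1/2)) * (mpow p (-(1/2)) * (mpow p (1/2) * mpow p (1/2))) := by
        rw [sqrt_sq hp, mul_assoc]
    _ = 1 := by
      rw [← mul_assoc (mpow p (-(1/2))) (mpow p (1/2)), isqrt_sqrt hp, one_mul, isqrt_sqrt hp]

lemma posDef_conj {S g : Matrix (Fin n) (Fin n) ℝ} (hS : S.PosDef) (hg : IsUnit g) :
    (gᵀ * S * g).PosDef := by
  have := hS.conjTranspose_mul_mul_same (B := g) (Matrix.mulVec_injective_of_isUnit hg)
  simpa using this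

lemma posDef_conj' {S g : Matrix (Fin n) (Fin n) ℝ} (hS : S.PosDef) (hg : IsUnit g) :
    (g * S * gᵀ).PosDef := by
  have := posDef_conj hS (g := gᵀ) ((Matrix.isUnit_transpose g).2 hg)
  simpa using this

/-- eigenvalue vector of the vectorial distance -/
lemma vecd_eq {p q : Matrix (Fin n) (Fin n) ℝ} (hp : p.PosDef) (hq : q.PosDef)
    {S : Matrix (Fin n) (Fin n) ℝ} (hS : S.PosDef) (hc : S.charpoly = (p⁻¹ * q).charpoly) (i : Fin n) :
    vecd p q i = Real.logb 2 (eigsDesc S i) := by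
  have key : (mpow p (-(1/2)) * mpow q (1/2))ᵀ * (mpow p (-(1/2)) * mpow q (1/2))
      = mpow q (1/2) * (p⁻¹ * mpow q (1/2)) := by
    rw [transpose_mul, mpow_symm hp, mpow_symm hq, ← isqrt_sq hp]
    simp only [mul_assoc]
  have hH : (mpow q (1/2) * (p⁻¹ * mpow q (1/2))).IsHermitian := by
    rw [← key]
    simpa using isHermitian_conjTranspose_mul_self (mpow p (-(1/2)) * mpow q (1/2))
  have : eigsDesc (mpow q (1/2) * (p⁻¹ * mpow q (1/2))) = eigsDesc S := by
    apply eigsDesc_congr hH hS.1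
    rw [hc, charpoly_mul_comm, mul_assoc, sqrt_sq hq]
  unfold vecd sigmaVec svals
  rw [key, this]
  rw [Real.logb, Real.log_sqrt (eigsDesc_pos hS i).le, Real.logb]
  ring

lemma rdist_eq {p q : Matrix (Fin n) (Fin n) ℝ} (hp : p.PosDef) (hq : q.PosDef)
    {S : Matrix (Fin n) (Fin n) ℝ} (hS : S.IsHermitian) (hc : S.charpoly = (p⁻¹ * q).charpoly) :
    rdist p q ^ 2 = ∑ i, (Real.logb 2 (hS.eigenvalues i)) ^ 2 := by
  have hH : (mpow p (-(1/2)) * q * mpow p (-(1/2))).IsHermitian := by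
    have := isHermitian_conjTranspose_mul_mul (mpow p (-(1/2))) hq.1
    rwa [conjTranspose_eq_transpose_of_trivial, mpow_symm hp] at this
  have : eigsDesc (mpow p (-(1/2)) * q * mpow p (-(1/2))) = eigsDesc S := by
    apply eigsDesc_congr hH hS
    rw [hc, charpoly_mul_comm, ← mul_assoc, isqrt_sq hp]
  unfold rdist
  rw [this, Real.sq_sqrt (Finset.sum_nonneg fun i _ => sq_nonneg _)]
  exact sum_eigsDesc hS (fun x => (Real.logb 2 x) ^ 2)

/-! ### Determinant inequalities -/

lemma one_le_det_one_add {k : ℕ} {C : Matrix (Fin k) (Fin k) ℝ} (hC : C.PosSemidef) :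
    1 ≤ (1 + C).det := by
  have hl := eigU_left hC.1
  have hr := mul_eq_one_comm.1 hl
  set U := (hC.1.eigenvectorUnitary : Matrix (Fin k) (Fin k) ℝ) with hU
  have h1 : 1 + C = U * diagonal (fun i => 1 + hC.1.eigenvalues i) * Uᵀ := by
    have : diagonal (fun i => 1 + hC.1.eigenvalues i) = 1 + diagonal hC.1.eigenvalues := by
      rw [← diagonal_one, diagonal_add]
    rw [this, mul_add, add_mul, mul_one, hr, ← spec_eig hC.1]
  rw [h1, det_mul_right_comm, hr, one_mul, det_diagonal]
  calc (1 : ℝ) = ∏ i : Fin k, (1 : ℝ) := by simp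
    _ ≤ _ := Finset.prod_le_prod (fun _ _ => zero_le_one)
      fun i _ => by linarith [hC.eigenvalues_nonneg i]

lemma det_mono {k : ℕ} {A B : Matrix (Fin k) (Fin k) ℝ} (hA : A.PosDef)
    (h : (B - A).PosSemidef) : A.det ≤ B.det := by
  set s := mpow A (1/2)
  set r := mpow A (-(1/2))
  have hC : (r * (B - A) * r).PosSemidef := by
    have := h.conjTranspose_mul_mul_same r
    rwa [conjTranspose_eq_transpose_of_trivial, mpow_symm hA] at this
  have hB : B = s * (1 + r * (B - A) * r) * s := by
    have e : s * (1 + r * (B - A) * r) * s = s * s + (s * r) * (B - A) * (r * s) := by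
      noncomm_ring
    rw [e, sqrt_sq hA, sqrt_isqrt hA, isqrt_sqrt hA]
    simp
  rw [hB, det_mul_right_comm, det_mul, sqrt_sq hA]
  nlinarith [one_le_det_one_add hC, hA.det_pos]

lemma det_smul_add_comm {k : ℕ} {c : ℝ} (hc : 0 < c) (F : Matrix (Fin k) (Fin k) ℝ) :
    (c • (1 : Matrix (Fin k) (Fin k) ℝ) + Fᵀ * F).det = (c • (1 : Matrix (Fin k) (Fin k) ℝ) + F * Fᵀ).det := by
  have h1 : c • (1 : Matrix (Fin k) (Fin k) ℝ) + Fᵀ * F = c • (1 + (c⁻¹ • Fᵀ) * F) := by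
    rw [smul_add, smul_mul_assoc, smul_smul, mul_inv_cancel₀ hc.ne', one_smul]
  have h2 : c • (1 : Matrix (Fin k) (Fin k) ℝ) + F * Fᵀ = c • (1 + F * (c⁻¹ • Fᵀ)) := by
    rw [smul_add, mul_smul_comm, smul_smul, mul_inv_cancel₀ hc.ne', one_smul]
  rw [h1, h2, det_smul, det_smul, det_one_add_mul_comm]

lemma isom_inj {k : ℕ} {V : Matrix (Fin n) (Fin k) ℝ} (hV : Vᵀ * V = 1) :
    Function.Injective V.mulVec := by
  intro x y hxy
  have := congrArg (Vᵀ.mulVec) hxy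
  simpa [mulVec_mulVec, hV] using this

lemma posDef_comp {k : ℕ} {V : Matrix (Fin n) (Fin k) ℝ} (hV : Vᵀ * V = 1)
    {S : Matrix (Fin n) (Fin n) ℝ} (hS : S.PosDef) : (Vᵀ * S * V).PosDef := by
  have := hS.conjTranspose_mul_mul_same (B := V) (isom_inj hV)
  simpa using this

lemma det_comp_diag_le {k : ℕ} (h : k ≤ n) {s : Fin n → ℝ} (hs : ∀ i, 0 < s i) (ha : Antitone s)
    {V : Matrix (Fin n) (Fin k) ℝ} (hV : Vᵀ * V = 1) :
    (Vᵀ * diagonal s * V).det ≤ ∏ j : Fin k, s (Fin.castLE h j) := by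
  rcases k with _ | k
  · simp
  set c := s (Fin.castLE h (Fin.last k)) with hc
  have hc0 : 0 < c := hs _
  have hcj : ∀ j : Fin (k+1), c ≤ s (Fin.castLE h j) := fun j =>
    ha (by simpa using Fin.le_last j)
  have hci : ∀ i : Fin n, (∀ j : Fin (k+1), Fin.castLE h j ≠ i) → s i ≤ c := by
    intro i hi
    apply ha
    by_contra hcon
    push Not at hcon
    have : (i : ℕ) < k + 1 := by
      have := Fin.lt_def.1 hcon
      simp at this
      omega
    exact hi ⟨i, this⟩ (by ext; simp)
  set V1 : Matrix (Fin (k+1)) (Fin (k+1)) ℝ := V.submatrix (Fin.castLE h) id with hV1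
  set e : Fin (k+1) → ℝ := fun j => s (Fin.castLE h j) - c with he
  have he0 : ∀ j, 0 ≤ e j := fun j => sub_nonneg.2 (hcj j)
  set F := diagonal (fun j => √(e j)) * V1 with hF
  have hFF : V1ᵀ * diagonal e * V1 = Fᵀ * F := by
    have : diagonal e = diagonal (fun j => √(e j)) * diagonal (fun j => √(e j)) := by
      rw [diagonal_mul_diagonal]
      congr 1; ext j
      exact (Real.mul_self_sqrt (he0 j)).symm
    rw [this, hF, transpose_mul, diagonal_transpose]
    simp only [Matrix.mul_assoc]
  -- step 1
  have step1 : (Vᵀ * diagonal s * V).det ≤ (Vᵀ * diagonal (fun i => max (s i) c) * V).det := by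
    apply det_mono (posDef_comp hV (PosDef.diagonal hs))
    rw [← Matrix.sub_mul, ← Matrix.mul_sub, diagonal_sub]
    have := (PosSemidef.diagonal (d := fun i => max (s i) c - s i)
      (fun i => by simp)).conjTranspose_mul_mul_same V
    simpa using this
  have step2 : Vᵀ * diagonal (fun i => max (s i) c) * V = c • 1 + Fᵀ * F := by
    rw [← hFF, ← hV]
    ext a b
    rw [Matrix.add_apply, Matrix.smul_apply, mul_apply, mul_apply, mul_apply]
    simp only [mul_diagonal, transpose_apply, smul_eq_mul, Finset.mul_sum]
    have : ∑ j, V1 j a * e j * V1 j b = ∑ i, V i a * (max (s i) c - c) * V i b := by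
      apply Fintype.sum_of_injective (Fin.castLE h) (Fin.castLE_injective h)
      · intro i hi
        have : s i ≤ c := hci i (fun j hj => hi ⟨j, hj⟩)
        simp [max_eq_right this]
      · intro j
        simp [hV1, he, max_eq_left (hcj j)]
    rw [this, ← Finset.sum_add_distrib]
    exact Finset.sum_congr rfl fun i _ => by ring
  have step3 : (c • (1 : Matrix (Fin (k+1)) (Fin (k+1)) ℝ) + F * Fᵀ).det ≤ (c • 1 + diagonal e).det := by
    apply det_mono
    · apply PosDef.add_posSemidef
      · exact PosDef.one.smul hc0
      · simpa using posSemidef_self_mul_conjTranspose F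
    · have hP : (1 - V * Vᵀ).PosSemidef := by
        have e1 : (1 - V * Vᵀ)ᴴ * (1 - V * Vᵀ) = 1 - V * Vᵀ := by
          have : V * Vᵀ * (V * Vᵀ) = V * Vᵀ := by
            rw [Matrix.mul_assoc, ← Matrix.mul_assoc Vᵀ, hV, Matrix.one_mul]
          simp [Matrix.sub_mul, Matrix.mul_sub, this]
        rw [← e1]
        exact posSemidef_conjTranspose_mul_self _
      have hP1 := (hP.submatrix (Fin.castLE h)).conjTranspose_mul_mul_same
        (diagonal (fun j => √(e j)))
      have e2 : (1 - V * Vᵀ).submatrix (Fin.castLE h) (Fin.castLE h) = 1 - V1 * V1ᵀ := by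
        rw [← submatrix_one (Fin.castLE h) (Fin.castLE_injective h)]
        rfl
      rw [e2] at hP1
      convert hP1 using 1
      have : diagonal e = diagonal (fun j => √(e j)) * diagonal (fun j => √(e j)) := by
        rw [diagonal_mul_diagonal]
        congr 1; ext j
        exact (Real.mul_self_sqrt (he0 j)).symm
      rw [this, hF, transpose_mul, diagonal_transpose, conjTranspose_eq_transpose_of_trivial, diagonal_transpose]
      simp only [Matrix.mul_sub, Matrix.sub_mul, Matrix.mul_one, Matrix.mul_assoc, add_sub_add_left_eq_sub]
  calc _ ≤ _ := step1
    _ = _ := by rw [step2, det_smul_add_comm hc0]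
    _ ≤ _ := step3
    _ = _ := by
      rw [← diagonal_one, ← diagonal_smul, diagonal_add, det_diagonal]
      exact Finset.prod_congr rfl fun j _ => by simp [he]

/-- Product of the top `k` eigenvalues. -/
def topk {k : ℕ} (h : k ≤ n) (S : Matrix (Fin n) (Fin n) ℝ) : ℝ :=
  ∏ j : Fin k, eigsDesc S (Fin.castLE h j)

lemma topk_pos {k : ℕ} (h : k ≤ n) {S : Matrix (Fin n) (Fin n) ℝ} (hS : S.PosDef) : 0 < topk h S :=
  Finset.prod_pos fun _ _ => eigsDesc_pos hS _

lemma det_comp_le {k : ℕ} (h : k ≤ n) {S : Matrix (Fin n) (Fin n) ℝ} (hS : S.PosDef)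
    {W : Matrix (Fin n) (Fin k) ℝ} (hW : Wᵀ * W = 1) : (Wᵀ * S * W).det ≤ topk h S := by
  obtain ⟨O, h1, h2, h3⟩ := spec_desc hS.1
  have := det_comp_diag_le h (eigsDesc_pos hS) (eigsDesc_antitone S) (V := Oᵀ * W) (by
    rw [transpose_mul, transpose_transpose, Matrix.mul_assoc, ← Matrix.mul_assoc O, h2, Matrix.one_mul, hW])
  have e : Wᵀ * S * W = (Oᵀ * W)ᵀ * diagonal (eigsDesc S) * (Oᵀ * W) := by
    conv_lhs => rw [h3]
    rw [transpose_mul, transpose_transpose]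
    simp only [Matrix.mul_assoc]
  rw [e]
  exact this

lemma exists_top {k : ℕ} (h : k ≤ n) {S : Matrix (Fin n) (Fin n) ℝ} (hS : S.PosDef) :
    ∃ W : Matrix (Fin n) (Fin k) ℝ, Wᵀ * W = 1 ∧
      S * W = W * diagonal (fun j => eigsDesc S (Fin.castLE h j)) := by
  obtain ⟨O, h1, h2, h3⟩ := spec_desc hS.1
  refine ⟨O.submatrix id (Fin.castLE h), ?_, ?_⟩
  · rw [transpose_submatrix, ← submatrix_mul Oᵀ O _ id _ Function.bijective_id, h1,
      submatrix_one _ (Fin.castLE_injective h)]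
  · have : S * O = O * diagonal (eigsDesc S) := by
      conv_lhs => rw [h3]
      rw [Matrix.mul_assoc, h1, Matrix.mul_one]
    ext i j
    have := congrFun (congrFun this i) (Fin.castLE h j)
    rw [mul_diagonal] at this ⊢
    simpa [mul_apply] using this

lemma qr {k : ℕ} {W : Matrix (Fin n) (Fin k) ℝ} (hW : Wᵀ * W = 1) {G : Matrix (Fin n) (Fin n) ℝ}
    (hG : IsUnit G) : ∃ (W' : Matrix (Fin n) (Fin k) ℝ) (R : Matrix (Fin k) (Fin k) ℝ),
      W'ᵀ * W' = 1 ∧ G * W = W' * R ∧ IsUnit R := by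
  have hP : (Wᵀ * (Gᵀ * 1 * G) * W).PosDef := posDef_comp hW (posDef_conj PosDef.one hG)
  set P := Wᵀ * (Gᵀ * 1 * G) * W with hPdef
  have hPe : P = (G * W)ᵀ * (G * W) := by
    rw [hPdef, transpose_mul, Matrix.mul_one]; simp only [Matrix.mul_assoc]
  refine ⟨G * W * mpow P (-(1/2)), mpow P (1/2), ?_, ?_, ?_⟩
  · rw [transpose_mul, mpow_symm hP]
    calc _ = mpow P (-(1/2)) * ((G * W)ᵀ * (G * W)) * mpow P (-(1/2)) := by
          simp only [Matrix.mul_assoc]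
      _ = (mpow P (-(1/2)) * mpow P (1/2)) * (mpow P (1/2) * mpow P (-(1/2))) := by
          rw [← hPe]
          have : mpow P (-(1/2)) * P * mpow P (-(1/2)) =
            mpow P (-(1/2)) * (mpow P (1/2) * mpow P (1/2)) * mpow P (-(1/2)) := by
              rw [sqrt_sq hP]
          rw [this]
          simp only [Matrix.mul_assoc]
      _ = 1 := by rw [isqrt_sqrt hP, sqrt_isqrt hP, Matrix.one_mul]
  · rw [Matrix.mul_assoc (G * W), isqrt_sqrt hP, Matrix.mul_one]
  · exact IsUnit.of_mul_eq_one _ (sqrt_isqrt hP)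

lemma det_qr {k : ℕ} {W W' : Matrix (Fin n) (Fin k) ℝ} {R : Matrix (Fin k) (Fin k) ℝ}
    {G : Matrix (Fin n) (Fin n) ℝ} (hG : G * W = W' * R) (S : Matrix (Fin n) (Fin n) ℝ) :
    (Wᵀ * (Gᵀ * S * G) * W).det = R.det ^ 2 * (W'ᵀ * S * W').det := by
  have : Wᵀ * (Gᵀ * S * G) * W = Rᵀ * (W'ᵀ * S * W') * R := by
    calc _ = (G * W)ᵀ * S * (G * W) := by rw [transpose_mul]; simp only [Matrix.mul_assoc]
      _ = _ := by rw [hG, transpose_mul]; simp only [Matrix.mul_assoc]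
  rw [this, det_mul, det_mul, det_transpose]
  ring

lemma topk_mid {k : ℕ} (h : k ≤ n) {S G Z L M : Matrix (Fin n) (Fin n) ℝ} (hS : S.PosDef)
    (hG : IsUnit G) (hSG : S * G = G * Z) (hZ : Z = L * M) (hL : IsUnit L) (hM : IsUnit M) :
    topk h S ^ 2 ≤ topk h (Lᵀ * 1 * L) * topk h (Mᵀ * 1 * M) := by
  obtain ⟨W, hW, hSW⟩ := exists_top h hS
  set D := diagonal (fun j => eigsDesc S (Fin.castLE h j)) with hD
  have hdet : D.det = topk h S := by rw [hD, det_diagonal]; rfl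
  have hGd : IsUnit G.det := (isUnit_iff_isUnit_det G).1 hG
  obtain ⟨W1, R, hW1, hWR, hR⟩ := qr hW (G := G⁻¹) ((isUnit_nonsing_inv_iff).2 hG)
  have hRd : IsUnit R.det := (isUnit_iff_isUnit_det R).1 hR
  have hZG : Z * G⁻¹ = G⁻¹ * S := by
    calc Z * G⁻¹ = G⁻¹ * (G * Z) * G⁻¹ := by rw [← Matrix.mul_assoc, nonsing_inv_mul _ hGd, Matrix.one_mul]
      _ = _ := by rw [← hSG, Matrix.mul_assoc, Matrix.mul_assoc, mul_nonsing_inv _ hGd, Matrix.mul_one]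
  have hZW : Z * W1 = W1 * (R * D * R⁻¹) := by
    have : Z * W1 * R = W1 * (R * D) := by
      rw [Matrix.mul_assoc, ← hWR, ← Matrix.mul_assoc, hZG, Matrix.mul_assoc, hSW, ← Matrix.mul_assoc, hWR, Matrix.mul_assoc]
    calc Z * W1 = Z * W1 * R * R⁻¹ := by rw [Matrix.mul_assoc _ R, mul_nonsing_inv _ hRd, Matrix.mul_one]
      _ = _ := by rw [this]; simp only [Matrix.mul_assoc]
  have h1 := det_qr hZW 1
  rw [Matrix.mul_one W1ᵀ, hW1, det_one, mul_one ((_ : ℝ) ^ 2), det_conj hR, hdet] at h1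
  obtain ⟨W2, R2, hW2, hWR2, -⟩ := qr hW1 hM
  have h2 := det_qr hWR2 (Lᵀ * 1 * L)
  have h3 := det_qr hWR2 1
  rw [Matrix.mul_one W2ᵀ, hW2, det_one, mul_one ((_ : ℝ) ^ 2)] at h3
  have e : Zᵀ * 1 * Z = Mᵀ * (Lᵀ * 1 * L) * M := by
    rw [hZ, transpose_mul]; simp only [Matrix.mul_assoc]
  rw [← h1, e, h2, ← h3, mul_comm]
  apply mul_le_mul
  · exact det_comp_le h (posDef_conj PosDef.one hL) hW2
  · exact det_comp_le h (posDef_conj PosDef.one hM) hW1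
  · exact (posDef_comp hW1 (posDef_conj PosDef.one hM)).det_pos.le
  · exact (topk_pos h (posDef_conj PosDef.one hL)).le

/-! ### Exponential families and the key inequality -/

/-- Entrywise derivative at `0` of a matrix-valued curve. -/
def HD {k l : ℕ} (M : ℝ → Matrix (Fin k) (Fin l) ℝ) (M' : Matrix (Fin k) (Fin l) ℝ) : Prop :=
  ∀ i j, HasDerivAt (fun t => M t i j) (M' i j) 0

lemma HD.mul {k l r : ℕ} {M : ℝ → Matrix (Fin k) (Fin l) ℝ} {M'} {N : ℝ → Matrix (Fin l) (Fin r) ℝ} {N'}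
    (hM : HD M M') (hN : HD N N') : HD (fun t => M t * N t) (M' * N 0 + M 0 * N') := by
  intro i j
  simp only [Matrix.add_apply, mul_apply]
  rw [← Finset.sum_add_distrib]
  exact HasDerivAt.fun_sum fun x _ => (hM i x).mul (hN x j)

lemma HD.const {k l : ℕ} (M : Matrix (Fin k) (Fin l) ℝ) : HD (fun _ => M) 0 :=
  fun _ _ => hasDerivAt_const _ _

/-- `exp(tA)` for `A = O diag(a) Oᵀ`. -/
def ef (O : Matrix (Fin n) (Fin n) ℝ) (a : Fin n → ℝ) (t : ℝ) : Matrix (Fin n) (Fin n) ℝ :=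
  O * diagonal (fun i => Real.exp (t * a i)) * Oᵀ

lemma ef_HD (O : Matrix (Fin n) (Fin n) ℝ) (a : Fin n → ℝ) (c : ℝ) :
    HD (fun t => ef O a (c * t)) (c • (O * diagonal a * Oᵀ)) := by
  have hd : HD (fun t => diagonal (fun i => Real.exp (c * t * a i))) (diagonal (fun i => c * a i)) := by
    intro i j
    by_cases h : i = j
    · subst h
      simp only [diagonal_apply_eq]
      have h1 : HasDerivAt (fun t : ℝ => c * t * a i) (c * a i) 0 := by
        simpa using ((hasDerivAt_id (0:ℝ)).const_mul c).mul_const (a i)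
      simpa using h1.exp
    · simp only [diagonal_apply_ne _ h]
      exact hasDerivAt_const _ _
  have := ((HD.const O).mul hd).mul (HD.const Oᵀ)
  convert this using 1
  · rfl
  · have e : diagonal (fun i => c * a i) = c • diagonal a := by
      rw [← diagonal_smul]; rfl
    simp [e]

lemma ef_zero {O : Matrix (Fin n) (Fin n) ℝ} (hO : O * Oᵀ = 1) (a : Fin n → ℝ) : ef O a 0 = 1 := by
  simp [ef, hO]

lemma ef_add {O : Matrix (Fin n) (Fin n) ℝ} (hO : Oᵀ * O = 1) (a : Fin n → ℝ) (s t : ℝ) :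
    ef O a s * ef O a t = ef O a (s + t) := by
  unfold ef
  calc _ = O * (diagonal (fun i => Real.exp (s * a i)) * (Oᵀ * O) *
        diagonal (fun i => Real.exp (t * a i))) * Oᵀ := by simp only [Matrix.mul_assoc]
    _ = _ := by
      rw [hO, mul_one, diagonal_mul_diagonal]
      simp only [← Real.exp_add, add_mul]

lemma ef_symm (O : Matrix (Fin n) (Fin n) ℝ) (a : Fin n → ℝ) (t : ℝ) : (ef O a t)ᵀ = ef O a t := by
  simp [ef, transpose_mul, mul_assoc]

lemma ef_unit {O : Matrix (Fin n) (Fin n) ℝ} (hO : Oᵀ * O = 1) (a : Fin n → ℝ) (t : ℝ) :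
    IsUnit (ef O a t) := by
  apply IsUnit.of_mul_eq_one (ef O a (-t))
  rw [ef_add hO, add_neg_cancel, ef_zero (mul_eq_one_comm.1 hO)]

lemma ef_posDef {O : Matrix (Fin n) (Fin n) ℝ} (hO : Oᵀ * O = 1) (a : Fin n → ℝ) (t : ℝ) :
    (ef O a t).PosDef := by
  unfold ef
  exact posDef_conj' (PosDef.diagonal fun i => Real.exp_pos _)
    (IsUnit.of_mul_eq_one _ (mul_eq_one_comm.1 hO))

lemma det_HD {k : ℕ} {M : ℝ → Matrix (Fin k) (Fin k) ℝ} {M'} (hM : HD M M') {d : Fin k → ℝ}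
    (h0 : M 0 = diagonal d) :
    HasDerivAt (fun t => (M t).det) (∑ j, (∏ i ∈ Finset.univ.erase j, d i) * M' j j) 0 := by
  have h1 : HasDerivAt (fun t => ∑ σ : Equiv.Perm (Fin k), ((Equiv.Perm.sign σ : ℤ) : ℝ) * ∏ i, M t (σ i) i)
      (∑ σ : Equiv.Perm (Fin k), ((Equiv.Perm.sign σ : ℤ) : ℝ) *
        ∑ j, (∏ i ∈ Finset.univ.erase j, M 0 (σ i) i) • M' (σ j) j) 0 := by
    apply HasDerivAt.fun_sum
    intro σ _
    exact (HasDerivAt.fun_finsetProd fun i _ => hM (σ i) i).const_mul _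
  simp only [det_apply']
  convert h1 using 1
  rw [Finset.sum_eq_single (1 : Equiv.Perm (Fin k))]
  · simp [h0]
  · intro σ _ hσ
    apply mul_eq_zero_of_right
    apply Finset.sum_eq_zero
    intro j _
    have : ∃ i, i ≠ j ∧ σ i ≠ i := by
      by_contra hcon
      push Not at hcon
      apply hσ
      ext i
      by_cases hi : i = j
      · subst hi
        by_contra hne
        have h2 : σ i ≠ i := fun h => hne (by simp [h])
        exact h2 (σ.injective (hcon _ h2))
      · simp [hcon i hi]
    obtain ⟨i, hij, hi⟩ := this
    have : ∏ i ∈ Finset.univ.erase j, M 0 (σ i) i = 0 :=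
      Finset.prod_eq_zero (i := i) (by simp [hij]) (by rw [h0, diagonal_apply_ne _ hi])
    rw [this, zero_smul]
  · simp

/-- The curve of matrices used in the key inequality. -/
def Sc (O Q : Matrix (Fin n) (Fin n) ℝ) (a b l : Fin n → ℝ) (t : ℝ) : Matrix (Fin n) (Fin n) ℝ :=
  ef O a ((-(1/2)) * t) * (diagonal (fun i => √(l i)) * ef Q b (1 * t) * diagonal (fun i => √(l i)))
    * ef O a ((-(1/2)) * t)

lemma sqd_unit {l : Fin n → ℝ} (hl : ∀ i, 0 < l i) : IsUnit (diagonal (fun i => √(l i))) :=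
  (PosDef.diagonal (d := fun i => √(l i)) fun i => Real.sqrt_pos.2 (hl i)).isUnit

lemma sqd_sq {l : Fin n → ℝ} (hl : ∀ i, 0 < l i) :
    diagonal (fun i => √(l i)) * diagonal (fun i => √(l i)) = diagonal l := by
  rw [diagonal_mul_diagonal]
  congr 1
  ext i
  exact Real.mul_self_sqrt (hl i).le

section key
variable {O Q : Matrix (Fin n) (Fin n) ℝ} {a b l : Fin n → ℝ}

lemma Sc_posDef (hO : Oᵀ * O = 1) (hQ : Qᵀ * Q = 1) (hl : ∀ i, 0 < l i) (t : ℝ) :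
    (Sc O Q a b l t).PosDef := by
  unfold Sc
  have h1 := posDef_conj' (ef_posDef hQ b (1 * t)) (sqd_unit hl)
  rw [diagonal_transpose] at h1
  have h2 := posDef_conj' h1 (ef_unit hO a ((-(1/2)) * t))
  rwa [ef_symm] at h2

lemma Sc_zero (hO : Oᵀ * O = 1) (hQ : Qᵀ * Q = 1) (hl : ∀ i, 0 < l i) :
    Sc O Q a b l 0 = diagonal l := by
  unfold Sc
  simp only [mul_zero, ef_zero (mul_eq_one_comm.1 hO), ef_zero (mul_eq_one_comm.1 hQ), mul_one, one_mul,
    sqd_sq hl]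

lemma Sc_mid {k : ℕ} (h : k ≤ n) (hO : Oᵀ * O = 1) (hQ : Qᵀ * Q = 1) (hl : ∀ i, 0 < l i) (t : ℝ) :
    topk h (Sc O Q a b l (t / 2)) ^ 2 ≤ topk h (Sc O Q a b l 0) * topk h (Sc O Q a b l t) := by
  set D := diagonal (fun i => √(l i)) with hD
  have hG := ef_unit hO a ((-(1/2)) * (t/2))
  have hM : IsUnit (ef Q b (t/2) * D * ef O a (-(1/2) * t)) :=
    ((ef_unit hQ b _).mul (sqd_unit hl)).mul (ef_unit hO a _)
  have hSG : Sc O Q a b l (t / 2) * ef O a ((-(1/2)) * (t/2)) = ef O a ((-(1/2)) * (t/2)) *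
      (D * (ef Q b (t/2) * D * ef O a (-(1/2) * t))) := by
    have e : ef O a (-(1/2) * t) = ef O a ((-(1/2)) * (t/2)) * ef O a ((-(1/2)) * (t/2)) := by
      rw [ef_add hO]; congr 1; ring
    rw [e]
    unfold Sc
    rw [one_mul]
    simp only [Matrix.mul_assoc]
    rfl
  have := topk_mid h (Sc_posDef hO hQ hl (t/2)) hG hSG rfl (sqd_unit hl) hM
  convert this using 3
  · rw [Sc_zero hO hQ hl, mul_one, hD, diagonal_transpose, sqd_sq hl]
  · have e : ef Q b (1 * t) = ef Q b (t/2) * ef Q b (t/2) := by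
      rw [ef_add hQ]; congr 1; ring
    unfold Sc
    rw [e, mul_one, transpose_mul, transpose_mul, ef_symm, ef_symm, hD, diagonal_transpose]
    simp only [Matrix.mul_assoc]

lemma key {k : ℕ} (h : k ≤ n) (hO : Oᵀ * O = 1) (hQ : Qᵀ * Q = 1) (hl : ∀ i, 0 < l i)
    (ha : Antitone l) :
    ∑ j : Fin k, Real.log (l (Fin.castLE h j)) +
      ∑ j : Fin k, ((Q * diagonal b * Qᵀ) (Fin.castLE h j) (Fin.castLE h j) -
        (O * diagonal a * Oᵀ) (Fin.castLE h j) (Fin.castLE h j))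
      ≤ Real.log (topk h (Sc O Q a b l 1)) := by
  set c := Fin.castLE h with hc
  set g : ℝ → ℝ := fun t => Real.log (topk h (Sc O Q a b l t)) with hg
  have hpos : ∀ t, 0 < topk h (Sc O Q a b l t) := fun t => topk_pos h (Sc_posDef hO hQ hl t)
  have hmid : ∀ t, 2 * g (t/2) ≤ g 0 + g t := by
    intro t
    have := Real.log_le_log (pow_pos (hpos _) 2) (Sc_mid h hO hQ hl t (a := a) (b := b))
    rw [Real.log_pow, Real.log_mul (hpos _).ne' (hpos _).ne'] at this
    exact_mod_cast this
  have hdy : ∀ N : ℕ, 2 ^ N * (g ((1/2)^N) - g 0) ≤ g 1 - g 0 := by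
    intro N
    induction N with
    | zero => simp
    | succ N ih =>
      refine le_trans ?_ ih
      have := hmid ((1/2)^N)
      have e : ((1/2 : ℝ))^N / 2 = (1/2)^(N+1) := by ring
      rw [e] at this
      have h2 : (0:ℝ) < 2 ^ N := by positivity
      rw [pow_succ (2:ℝ)]
      nlinarith
  set ψ : ℝ → ℝ := fun t => ((Sc O Q a b l t).submatrix c c).det with hψ
  -- comparison with the principal minor
  set P : Matrix (Fin n) (Fin k) ℝ := (1 : Matrix (Fin n) (Fin n) ℝ).submatrix id c with hP
  have hPP : Pᵀ * P = 1 := by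
    rw [hP, transpose_submatrix, ← submatrix_mul _ _ _ id _ Function.bijective_id, transpose_one, one_mul,
      submatrix_one _ (Fin.castLE_injective h)]
  have hPS : ∀ S : Matrix (Fin n) (Fin n) ℝ, Pᵀ * S * P = S.submatrix c c := by
    intro S
    have h1 : S * P = S.submatrix id c := by
      ext i j; simp [hP, mul_apply, one_apply]
    rw [Matrix.mul_assoc, h1]
    ext i j; simp [hP, mul_apply, one_apply]
  have hψpos : ∀ t, 0 < ψ t := by
    intro t
    have := (posDef_comp hPP (Sc_posDef hO hQ hl t (a := a) (b := b))).det_pos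
    rwa [hPS] at this
  have hψg : ∀ t, Real.log (ψ t) ≤ g t := by
    intro t
    apply Real.log_le_log (hψpos t)
    have := det_comp_le h (Sc_posDef hO hQ hl t (a := a) (b := b)) hPP
    rwa [hPS] at this
  have hψ0 : ψ 0 = ∏ j, l (c j) := by
    simp only [hψ]
    rw [Sc_zero hO hQ hl, submatrix_diagonal _ _ (Fin.castLE_injective h), det_diagonal]
    rfl
  have hg0 : g 0 ≤ Real.log (ψ 0) := by
    apply Real.log_le_log (hpos 0)
    rw [hψ0]
    obtain ⟨W, hW, hSW⟩ := exists_top h (Sc_posDef hO hQ hl 0 (a := a) (b := b))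
    have := det_comp_diag_le h hl ha hW
    rw [← Sc_zero hO hQ hl (a := a) (b := b), Matrix.mul_assoc, hSW, ← Matrix.mul_assoc, hW, Matrix.one_mul, det_diagonal] at this
    exact this
  set A := O * diagonal a * Oᵀ with hA
  set B := Q * diagonal b * Qᵀ with hB
  set δ := ∑ j : Fin k, (B (c j) (c j) - A (c j) (c j)) with hδ
  have hder : HasDerivAt ψ (ψ 0 * δ) 0 := by
    set D := diagonal (fun i => √(l i)) with hD
    have h1 := ((ef_HD O a (-(1/2))).mul (((HD.const D).mul (ef_HD Q b 1)).mul (HD.const D))).mul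
      (ef_HD O a (-(1/2)))
    have h2 : HD (fun t => (Sc O Q a b l t).submatrix c c) _ := fun i j => h1 (c i) (c j)
    have h3 := det_HD h2 (d := fun j => l (c j)) (by
      rw [Sc_zero hO hQ hl, submatrix_diagonal _ _ (Fin.castLE_injective h)]; rfl)
    convert h3 using 1
    rw [hδ, hψ0, Finset.mul_sum]
    refine Finset.sum_congr rfl fun j _ => ?_
    rw [← Finset.mul_prod_erase _ _ (Finset.mem_univ j)]
    simp only [mul_zero, ef_zero (mul_eq_one_comm.1 hO), ef_zero (mul_eq_one_comm.1 hQ), mul_one, one_mul,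
      zero_add, add_zero, one_smul]
    rw [← hA, ← hB, hD, sqd_sq hl]
    simp only [Matrix.add_apply, smul_mul_assoc, mul_smul_comm, Matrix.smul_apply, mul_diagonal, diagonal_mul, smul_eq_mul]
    have := Real.mul_self_sqrt (hl (c j)).le
    linear_combination (-(∏ x ∈ Finset.univ.erase j, l (c x)) * B (c j) (c j)) * this
  have hlog : HasDerivAt (fun t => Real.log (ψ t)) δ 0 := by
    have := hder.log (hψpos 0).ne'
    rwa [mul_div_cancel_left₀ _ (hψpos 0).ne'] at this
  have hlim : Filter.Tendsto (fun N : ℕ => (2:ℝ)^N * (Real.log (ψ ((1/2)^N)) - Real.log (ψ 0)))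
      Filter.atTop (nhds δ) := by
    have h1 := hlog.tendsto_slope_zero_right
    have h2 : Filter.Tendsto (fun N : ℕ => (1/2 : ℝ)^N) Filter.atTop (nhdsWithin 0 (Set.Ioi 0)) := by
      rw [tendsto_nhdsWithin_iff]
      exact ⟨tendsto_pow_atTop_nhds_zero_of_lt_one (by norm_num) (by norm_num),
        Filter.Eventually.of_forall fun N => by simp⟩
    have h3 := h1.comp h2
    refine h3.congr fun N => ?_
    simp
  have hle : δ ≤ g 1 - g 0 := by
    refine le_of_tendsto' hlim fun N => le_trans ?_ (hdy N)
    have := hψg ((1/2)^N)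
    gcongr
  have hs : ∑ j : Fin k, Real.log (l (c j)) = Real.log (ψ 0) := by
    rw [hψ0, Real.log_prod]
    exact fun i _ => (hl _).ne'
  rw [hs]
  have := hψg 0
  show _ ≤ g 1
  linarith

end key

/-! ### The Karcher equation -/

lemma sum_eig {O S : Matrix (Fin n) (Fin n) ℝ} (hO : Oᵀ * O = 1) {y : Fin n → ℝ}
    (hS : S.IsHermitian) (he : S = O * diagonal y * Oᵀ) (f : ℝ → ℝ) :
    ∑ i, f (hS.eigenvalues i) = ∑ i, f (y i) := by
  have h1 := hS.roots_charpoly_eq_eigenvalues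
  have h2 : S.charpoly = ∏ i, (Polynomial.X - Polynomial.C (y i)) := by
    rw [he, charpoly_mul_comm, ← mul_assoc, hO, one_mul, charpoly_diagonal]
  have h3 : (∏ i, (Polynomial.X - Polynomial.C (y i))).roots = Finset.univ.val.map y := by
    have := Polynomial.roots_multiset_prod_X_sub_C (Finset.univ.val.map y)
    rw [Multiset.map_map] at this
    exact this
  rw [h2, h3] at h1
  have h4 := congrArg (fun m => (Multiset.map f m).sum) h1
  simp only [Multiset.map_map] at h4
  exact h4.symm

lemma log_ineq {α x y : ℝ} (hα : 0 < α) (hx : α ≤ x) (hy : α ≤ y) :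
    Real.log y ^ 2 ≤ Real.log x ^ 2 + 2 * Real.log x / x * (y - x) +
      (2 * |Real.log x| + 1) / α ^ 2 * (y - x) ^ 2 := by
  have hx0 : 0 < x := hα.trans_le hx
  have hy0 : 0 < y := hα.trans_le hy
  set r := Real.log y - Real.log x with hr
  have h1 : r ≤ (y - x) / x := by
    have := Real.log_le_sub_one_of_pos (div_pos hy0 hx0)
    rw [Real.log_div hy0.ne' hx0.ne'] at this
    rw [sub_div, div_self hx0.ne']; exact this
  have h2 : (y - x) / y ≤ r := by
    have := Real.log_le_sub_one_of_pos (div_pos hx0 hy0)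
    rw [Real.log_div hx0.ne' hy0.ne'] at this
    rw [sub_div, div_self hy0.ne']; linarith
  have h3 : r ^ 2 ≤ (y - x) ^ 2 / α ^ 2 := by
    have e1 : (y - x) / x ≤ |y - x| / α :=
      (div_le_div_of_nonneg_right (le_abs_self _) hx0.le).trans
        (div_le_div_of_nonneg_left (abs_nonneg _) hα hx)
    have e2 : -(|y - x| / α) ≤ (y - x) / y := by
      have e3 : |y - x| / y ≤ |y - x| / α := div_le_div_of_nonneg_left (abs_nonneg _) hα hy
      have e4 : -|y - x| / y ≤ (y - x) / y := div_le_div_of_nonneg_right (neg_abs_le _) hy0.le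
      rw [neg_div] at e4
      linarith
    have e5 : r ^ 2 ≤ (|y - x| / α) ^ 2 := sq_le_sq' (by linarith) (by linarith)
    rwa [div_pow, sq_abs] at e5
  have h4 : |r - (y - x) / x| ≤ (y - x) ^ 2 / α ^ 2 := by
    rw [abs_of_nonpos (by linarith)]
    have e : (y - x) / x - (y - x) / y = (y - x) ^ 2 / (x * y) := by field_simp
    have e2 : (y - x) ^ 2 / (x * y) ≤ (y - x) ^ 2 / α ^ 2 := by
      apply div_le_div_of_nonneg_left (sq_nonneg _) (by positivity)
      nlinarith
    linarith
  have h5 : Real.log x * (r - (y - x) / x) ≤ |Real.log x| * ((y - x) ^ 2 / α ^ 2) := by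
    calc _ ≤ |Real.log x * (r - (y - x) / x)| := le_abs_self _
      _ = |Real.log x| * |r - (y - x) / x| := abs_mul _ _
      _ ≤ _ := by gcongr
  have e1 : Real.log y = Real.log x + r := by rw [hr]; ring
  have e2 : (2 * |Real.log x| + 1) / α ^ 2 * (y - x) ^ 2 =
    2 * (|Real.log x| * ((y - x) ^ 2 / α ^ 2)) + (y - x) ^ 2 / α ^ 2 := by ring
  have e3 : 2 * Real.log x / x * (y - x) = 2 * (Real.log x * ((y - x) / x)) := by ring
  rw [e1, e2, e3]
  nlinarith

lemma tr_bil {O Q : Matrix (Fin n) (Fin n) ℝ} (α β : Fin n → ℝ) :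
    ((O * diagonal α * Oᵀ) * (Q * diagonal β * Qᵀ)).trace =
      ∑ i, ∑ j, ((Oᵀ * Q) i j) ^ 2 * (α i * β j) := by
  have : ((O * diagonal α * Oᵀ) * (Q * diagonal β * Qᵀ)).trace =
      (diagonal α * (Oᵀ * Q) * (diagonal β * (Oᵀ * Q)ᵀ)).trace := by
    rw [transpose_mul, transpose_transpose]
    calc _ = (O * (diagonal α * Oᵀ * Q * diagonal β * Qᵀ)).trace := by simp only [mul_assoc]
      _ = _ := by rw [trace_mul_comm]; simp only [mul_assoc]
  rw [this, trace]
  refine Finset.sum_congr rfl fun i _ => ?_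
  rw [diag_apply, mul_apply]
  refine Finset.sum_congr rfl fun j _ => ?_
  rw [diagonal_mul, diagonal_mul, transpose_apply]
  ring

lemma klein {O Q : Matrix (Fin n) (Fin n) ℝ} (hO : Oᵀ * O = 1) (hQ : Qᵀ * Q = 1)
    (x y : Fin n → ℝ) (f f' : ℝ → ℝ) (C : ℝ)
    (hf : ∀ i j, f (y j) ≤ f (x i) + f' (x i) * (y j - x i) + C * (y j - x i) ^ 2)
    {X Y : Matrix (Fin n) (Fin n) ℝ} (hX : X = O * diagonal x * Oᵀ) (hY : Y = Q * diagonal y * Qᵀ) :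
    ∑ j, f (y j) ≤ ∑ i, f (x i) + ((O * diagonal (fun i => f' (x i)) * Oᵀ) * (Y - X)).trace +
      C * ((Y - X) * (Y - X)).trace := by
  set K := Oᵀ * Q with hK
  have hO' := mul_eq_one_comm.1 hO
  have hQ' := mul_eq_one_comm.1 hQ
  have hrow : ∀ i, ∑ j, K i j ^ 2 = 1 := by
    intro i
    have : K * Kᵀ = 1 := by
      rw [hK, transpose_mul, transpose_transpose, mul_assoc, ← mul_assoc Q, hQ', one_mul, hO]
    have := congrFun (congrFun this i) i
    rw [mul_apply, one_apply_eq] at this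
    rw [← this]
    exact Finset.sum_congr rfl fun j _ => by rw [transpose_apply]; ring
  have hcol : ∀ j, ∑ i, K i j ^ 2 = 1 := by
    intro j
    have : Kᵀ * K = 1 := by
      rw [hK, transpose_mul, transpose_transpose, mul_assoc, ← mul_assoc O, hO', one_mul, hQ]
    have := congrFun (congrFun this j) j
    rw [mul_apply, one_apply_eq] at this
    rw [← this]
    exact Finset.sum_congr rfl fun j _ => by rw [transpose_apply]; ring
  have hL : ∀ α : Fin n → ℝ, ∑ i, α i = ∑ i, ∑ j, K i j ^ 2 * α i := by
    intro α
    refine Finset.sum_congr rfl fun i _ => ?_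
    rw [← Finset.sum_mul, hrow, one_mul]
  have hR : ∀ β : Fin n → ℝ, ∑ j, β j = ∑ i, ∑ j, K i j ^ 2 * β j := by
    intro β
    rw [Finset.sum_comm]
    refine Finset.sum_congr rfl fun i _ => ?_
    rw [← Finset.sum_mul, hcol, one_mul]
  have hself : ∀ (P : Matrix (Fin n) (Fin n) ℝ) (_ : Pᵀ * P = 1) (α β : Fin n → ℝ),
      ((P * diagonal α * Pᵀ) * (P * diagonal β * Pᵀ)).trace = ∑ i, α i * β i := by
    intro P hP α β
    rw [tr_bil, hP]
    refine Finset.sum_congr rfl fun i _ => ?_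
    rw [Finset.sum_eq_single i]
    · simp
    · intro j _ hj
      simp [one_apply_ne hj.symm]
    · simp
  have e1 : ((O * diagonal (fun i => f' (x i)) * Oᵀ) * (Y - X)).trace =
      ∑ i, ∑ j, K i j ^ 2 * (f' (x i) * y j) - ∑ i, ∑ j, K i j ^ 2 * (f' (x i) * x i) := by
    rw [mul_sub, trace_sub, hX, hY, hself O hO, tr_bil, hL (fun i => f' (x i) * x i)]
  have e2 : ((Y - X) * (Y - X)).trace = ∑ i, ∑ j, K i j ^ 2 * (y j * y j) -
      2 * ∑ i, ∑ j, K i j ^ 2 * (x i * y j) + ∑ i, ∑ j, K i j ^ 2 * (x i * x i) := by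
    rw [mul_sub, sub_mul, sub_mul, trace_sub, trace_sub, trace_sub, trace_mul_comm Y X, hX, hY,
      hself O hO, hself Q hQ, tr_bil, hL (fun i => x i * x i), hR (fun j => y j * y j)]
    rw [← hK]
    ring
  rw [e1, e2, hL (fun i => f (x i)), hR (fun j => f (y j))]
  have : ∀ i j, K i j ^ 2 * f (y j) ≤ K i j ^ 2 * (f (x i) + f' (x i) * (y j - x i) + C * (y j - x i) ^ 2) :=
    fun i j => mul_le_mul_of_nonneg_left (hf i j) (sq_nonneg _)
  calc _ ≤ ∑ i, ∑ j, K i j ^ 2 * (f (x i) + f' (x i) * (y j - x i) + C * (y j - x i) ^ 2) :=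
        Finset.sum_le_sum fun i _ => Finset.sum_le_sum fun j _ => this i j
    _ = _ := by
      simp only [Finset.mul_sum, ← Finset.sum_sub_distrib, ← Finset.sum_add_distrib]
      refine Finset.sum_congr rfl fun i _ => Finset.sum_congr rfl fun j _ => ?_
      ring

lemma exists_bound {H : Matrix (Fin n) (Fin n) ℝ} (hH : H.IsHermitian) :
    ∃ c : ℝ, 0 ≤ c ∧ (c • 1 - H).PosSemidef := by
  refine ⟨∑ i, |hH.eigenvalues i|, Finset.sum_nonneg fun _ _ => abs_nonneg _, ?_⟩
  set c := ∑ i, |hH.eigenvalues i| with hc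
  have h := spec_eig hH
  have hr := mul_eq_one_comm.1 (eigU_left hH)
  set U := (hH.eigenvectorUnitary : Matrix (Fin n) (Fin n) ℝ) with hU
  have e : c • 1 - H = U * diagonal (fun i => c - hH.eigenvalues i) * Uᵀ := by
    have : diagonal (fun i => c - hH.eigenvalues i) = c • 1 - diagonal hH.eigenvalues := by
      rw [← diagonal_one, ← diagonal_smul, diagonal_sub]
      simp
    rw [this, mul_sub, sub_mul, ← h]
    simp [hr]
  rw [e]
  have := (PosSemidef.diagonal (d := fun i => c - hH.eigenvalues i) (fun i => by
    have h1 : |hH.eigenvalues i| ≤ c :=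
      Finset.single_le_sum (f := fun i => |hH.eigenvalues i|) (fun _ _ => abs_nonneg _) (Finset.mem_univ i)
    have h2 := le_abs_self (hH.eigenvalues i)
    simp only [Pi.zero_apply]
    linarith)).mul_mul_conjTranspose_same U
  simpa using this

lemma R_psd {H : Matrix (Fin n) (Fin n) ℝ} (hH : Hᵀ = H) {c t : ℝ} (hc : (c • 1 - H).PosSemidef)
    (ht : 0 ≤ t) (htc : 4 * t * c ≤ 1) :
    ((1 - t • H)ᵀ * (1 - t • H) - (1/2 : ℝ) • 1).PosSemidef := by
  have e : (1 - t • H)ᵀ * (1 - t • H) - (1/2 : ℝ) • 1 =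
      (1/2 - 2 * t * c) • 1 + (2 * t) • (c • 1 - H) + (t • H)ᴴ * (t • H) := by
    simp only [transpose_sub, transpose_one, transpose_smul, hH, conjTranspose_eq_transpose_of_trivial,
      sub_mul, mul_sub, one_mul, mul_one, smul_sub, smul_smul, sub_smul, two_mul, add_smul, add_mul]
    module
  rw [e]
  refine ((PosSemidef.one.smul (by linarith)).add (hc.smul (by linarith))).add
    (posSemidef_conjTranspose_mul_self _)

lemma R_unit {H : Matrix (Fin n) (Fin n) ℝ} (hH : Hᵀ = H) {c t : ℝ} (hc : (c • 1 - H).PosSemidef)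
    (ht : 0 ≤ t) (htc : 4 * t * c ≤ 1) : IsUnit (1 - t • H) := by
  have h1 : ((1 - t • H)ᵀ * (1 - t • H)).PosDef := by
    have := (PosDef.one (n := Fin n) (R := ℝ).smul (show (0:ℝ) < 1/2 by norm_num)).add_posSemidef
      (R_psd hH hc ht htc)
    simpa using this
  have := h1.isUnit
  rw [isUnit_iff_isUnit_det, det_mul] at this
  exact (isUnit_iff_isUnit_det _).2 (isUnit_of_mul_isUnit_right this)


set_option maxHeartbeats 2000000 in
lemma step {H O : Matrix (Fin n) (Fin n) ℝ} (hH : Hᵀ = H) {c : ℝ} (hc : (c • 1 - H).PosSemidef)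
    (hO : Oᵀ * O = 1) (a : Fin n → ℝ) :
    ∃ K : ℝ, ∀ t : ℝ, 0 < t → t ≤ 1 → 4 * t * c ≤ 1 →
      ∀ hY : ((1 - t • H) * ef O a 1 * (1 - t • H)).IsHermitian,
      ∑ j, Real.log (hY.eigenvalues j) ^ 2 ≤
        ∑ i, a i ^ 2 - 4 * t * ((O * diagonal a * Oᵀ) * H).trace + t ^ 2 * K := by
  set X := ef O a 1 with hX
  set x : Fin n → ℝ := fun i => Real.exp (1 * a i) with hx
  have hXe : X = O * diagonal x * Oᵀ := rfl
  have hO' := mul_eq_one_comm.1 hO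
  set x0 := Real.exp (-∑ i, |a i|) with hx0
  have hx0pos : 0 < x0 := Real.exp_pos _
  have hxx0 : ∀ i, x0 ≤ x i := by
    intro i
    apply Real.exp_le_exp.2
    have h1 : |a i| ≤ ∑ i, |a i| :=
      Finset.single_le_sum (f := fun i => |a i|) (fun _ _ => abs_nonneg _) (Finset.mem_univ i)
    have h2 := neg_abs_le (a i)
    linarith
  have hXpsd : (X - x0 • 1).PosSemidef := by
    have e : X - x0 • 1 = O * diagonal (fun i => x i - x0) * Oᵀ := by
      have : diagonal (fun i => x i - x0) = diagonal x - x0 • 1 := by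
        rw [← diagonal_one, ← diagonal_smul, diagonal_sub]
        simp
      rw [this, mul_sub, sub_mul, ← hXe]
      simp [hO']
    rw [e]
    have := (PosSemidef.diagonal (d := fun i => x i - x0) (fun i => by
      simp only [Pi.zero_apply]
      linarith [hxx0 i])).mul_mul_conjTranspose_same O
    simpa using this
  set α := x0 / 2 with hα
  have hαpos : 0 < α := by positivity
  set C := ∑ i, (2 * |a i| + 1) / α ^ 2 with hC
  have hC0 : 0 ≤ C := Finset.sum_nonneg fun i _ => by positivity
  set A := O * diagonal a * Oᵀ with hA
  set Φ := O * diagonal (fun i => 2 * Real.log (x i) / x i) * Oᵀ with hΦ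
  have hlogx : ∀ i, Real.log (x i) = a i := fun i => by simp [hx]
  have hΦX : Φ * X = (2:ℝ) • A := by
    rw [hΦ, hXe, hA]
    calc _ = O * (diagonal (fun i => 2 * Real.log (x i) / x i) * (Oᵀ * O) * diagonal x) * Oᵀ := by
          simp only [mul_assoc]
      _ = _ := by
        rw [hO, mul_one, diagonal_mul_diagonal, ← smul_mul_assoc, ← mul_smul_comm, ← diagonal_smul]
        congr 3
        ext i
        rw [hlogx, div_mul_cancel₀ _ (Real.exp_pos _).ne']
        rfl
  have hXΦ : X * Φ = (2:ℝ) • A := by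
    rw [hΦ, hXe, hA]
    calc _ = O * (diagonal x * (Oᵀ * O) * diagonal (fun i => 2 * Real.log (x i) / x i)) * Oᵀ := by
          simp only [mul_assoc]
      _ = _ := by
        rw [hO, mul_one, diagonal_mul_diagonal, ← smul_mul_assoc, ← mul_smul_comm, ← diagonal_smul]
        congr 3
        ext i
        rw [hlogx, mul_div_cancel₀ _ (Real.exp_pos _).ne']
        rfl
  set E1 := H * X + X * H with hE1
  set E2 := H * X * H with hE2
  refine ⟨(Φ * E2).trace + C * (|(E1 * E1).trace| + 2 * |(E1 * E2).trace| + |(E2 * E2).trace|), ?_⟩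
  intro t ht ht1 htc hY
  have hR : (1 - t • H)ᵀ = 1 - t • H := by simp [hH]
  set R := 1 - t • H with hRdef
  set Y := R * X * R with hYdef
  have hYX : Y - X = t ^ 2 • E2 - t • E1 := by
    rw [hYdef, hRdef, hE1, hE2]
    simp only [sub_mul, mul_sub, one_mul, mul_one, smul_mul_assoc, mul_smul_comm, mul_assoc]
    module
  set Q := (hY.eigenvectorUnitary : Matrix (Fin n) (Fin n) ℝ) with hQ
  have hQQ : Qᵀ * Q = 1 := eigU_left hY
  have hYs : Y = Q * diagonal hY.eigenvalues * Qᵀ := spec_eig hY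
  have hYpsd : (Y - α • 1).PosSemidef := by
    have h1 := hXpsd.mul_mul_conjTranspose_same R
    have h2 := (R_psd hH hc ht.le htc).smul hx0pos.le
    have h3 := h1.add h2
    convert h3 using 1
    rw [conjTranspose_eq_transpose_of_trivial, ← hRdef, hR, hYdef]
    simp only [mul_sub, sub_mul, mul_smul_comm, smul_mul_assoc, mul_one, smul_sub, smul_smul]
    rw [hα, show x0 * (1/2) = x0 / 2 by ring]
    abel
  have hyα : ∀ j, α ≤ hY.eigenvalues j := by
    intro j
    have h1 := hYpsd.conjTranspose_mul_mul_same Q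
    have h2 := h1.diag_nonneg (i := j)
    have e : Qᴴ * (Y - α • 1) * Q = diagonal (fun i => hY.eigenvalues i - α) := by
      have : diagonal (fun i => hY.eigenvalues i - α) = diagonal hY.eigenvalues - α • 1 := by
        rw [← diagonal_one, ← diagonal_smul, diagonal_sub]
        simp
      rw [conjTranspose_eq_transpose_of_trivial, this, mul_sub, sub_mul]
      congr 1
      · conv_lhs => rw [hYs]
        calc _ = (Qᵀ * Q) * diagonal hY.eigenvalues * (Qᵀ * Q) := by simp only [mul_assoc]
          _ = _ := by rw [hQQ, one_mul, mul_one]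
      · simp [hQQ]
    rw [e, diagonal_apply_eq] at h2
    linarith
  have hk := klein hO hQQ x hY.eigenvalues (fun s => Real.log s ^ 2) (fun s => 2 * Real.log s / s) C
    (fun i j => by
      have hxi : α ≤ x i := by have := hxx0 i; linarith
      refine (log_ineq hαpos hxi (hyα j)).trans ?_
      have : (2 * |Real.log (x i)| + 1) / α ^ 2 ≤ C := by
        rw [hlogx]
        exact Finset.single_le_sum (f := fun i => (2 * |a i| + 1) / α ^ 2)
          (fun i _ => by positivity) (Finset.mem_univ i)
      gcongr) hXe hYs
  refine hk.trans ?_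
  simp only [hlogx]
  have t1 : (Φ * E1).trace = 4 * (A * H).trace := by
    rw [hE1, mul_add, trace_add, ← mul_assoc, ← mul_assoc, hΦX, trace_mul_comm (Φ * H), ← mul_assoc, hXΦ]
    simp only [smul_mul_assoc, trace_smul, smul_eq_mul]
    ring
  have t2 : (Φ * (Y - X)).trace = t ^ 2 * (Φ * E2).trace - 4 * t * (A * H).trace := by
    rw [hYX, mul_sub, trace_sub, mul_smul_comm, mul_smul_comm, trace_smul, trace_smul, t1]
    simp only [smul_eq_mul]
    ring
  have t3 : ((Y - X) * (Y - X)).trace = t ^ 2 * ((E1 * E1).trace - 2 * t * (E1 * E2).trace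
      + t ^ 2 * (E2 * E2).trace) := by
    rw [hYX]
    simp only [mul_sub, sub_mul, trace_sub, mul_smul_comm, smul_mul_assoc, trace_smul, smul_eq_mul]
    rw [trace_mul_comm E2 E1]
    ring
  have t4 : (E1 * E1).trace - 2 * t * (E1 * E2).trace + t ^ 2 * (E2 * E2).trace ≤
      |(E1 * E1).trace| + 2 * |(E1 * E2).trace| + |(E2 * E2).trace| := by
    have h1 := le_abs_self (E1 * E1).trace
    have h2 : -(t * (E1 * E2).trace) ≤ |(E1 * E2).trace| := by
      calc _ ≤ |t * (E1 * E2).trace| := neg_le_abs _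
        _ = t * |(E1 * E2).trace| := by rw [abs_mul, abs_of_pos ht]
        _ ≤ _ := mul_le_of_le_one_left (abs_nonneg _) ht1
    have h3 : t ^ 2 * (E2 * E2).trace ≤ |(E2 * E2).trace| := by
      calc _ ≤ t ^ 2 * |(E2 * E2).trace| := by gcongr; exact le_abs_self _
        _ ≤ _ := mul_le_of_le_one_left (abs_nonneg _) (pow_le_one₀ ht.le ht1)
    linarith
  have t2' : (O * diagonal (fun i => 2 * a i / x i) * Oᵀ * (Y - X)).trace = (Φ * (Y - X)).trace := by
    rw [hΦ]; simp only [hlogx]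
  rw [t2', t2, t3]
  have := mul_le_mul_of_nonneg_left t4 (mul_nonneg hC0 (sq_nonneg t))
  nlinarith

lemma charpoly_conj {h P Q : Matrix (Fin n) (Fin n) ℝ} (hh : IsUnit h) :
    ((h * P * hᵀ)⁻¹ * (h * Q * hᵀ)).charpoly = (P⁻¹ * Q).charpoly := by
  have hd : IsUnit h.det := (isUnit_iff_isUnit_det _).1 hh
  have hd' : IsUnit hᵀ.det := by rwa [det_transpose]
  rw [Matrix.mul_inv_rev, Matrix.mul_inv_rev]
  have e : hᵀ⁻¹ * (P⁻¹ * h⁻¹) * (h * Q * hᵀ) = hᵀ⁻¹ * (P⁻¹ * (h⁻¹ * h) * Q * hᵀ) := by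
    simp only [mul_assoc]
  rw [e, nonsing_inv_mul _ hd, mul_one, charpoly_mul_comm, mul_assoc, mul_nonsing_inv _ hd', mul_one]

lemma rd_conj {h S : Matrix (Fin n) (Fin n) ℝ} (hh : IsUnit h) (hS : S.PosDef) :
    rdist (h * hᵀ) (h * S * hᵀ) ^ 2 = (∑ i, Real.log (hS.1.eigenvalues i) ^ 2) / Real.log 2 ^ 2 := by
  have h1 : (h * hᵀ).PosDef := by
    have := posDef_conj' (PosDef.one (n := Fin n) (R := ℝ)) hh
    rwa [mul_one] at this
  rw [rdist_eq h1 (posDef_conj' hS hh) hS.1 (by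
    have := charpoly_conj (P := 1) (Q := S) hh
    rw [mul_one, inv_one, one_mul] at this
    exact this.symm)]
  rw [Finset.sum_div]
  refine Finset.sum_congr rfl fun i _ => ?_
  rw [Real.logb, div_pow]

lemma karcher {m : ℕ} {ω : Fin m → ℝ} (hω : ∀ i, 0 ≤ ω i)
    {p O : Fin m → Matrix (Fin n) (Fin n) ℝ} {a : Fin m → Fin n → ℝ} {g : Matrix (Fin n) (Fin n) ℝ}
    (hg : IsUnit g) (hO : ∀ i, (O i)ᵀ * O i = 1) (hp : ∀ i, p i = g * ef (O i) (a i) 1 * gᵀ)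
    (hmin : ∀ q : Matrix (Fin n) (Fin n) ℝ, q.PosDef →
      ∑ i, ω i * (rdist (g * gᵀ) (p i)) ^ 2 ≤ ∑ i, ω i * (rdist q (p i)) ^ 2) :
    ∑ i, ω i • (O i * diagonal (a i) * (O i)ᵀ) = 0 := by
  set A : Fin m → Matrix (Fin n) (Fin n) ℝ := fun i => O i * diagonal (a i) * (O i)ᵀ with hA
  set H := ∑ i, ω i • A i with hHdef
  have hH : Hᵀ = H := by
    rw [hHdef, transpose_sum]
    refine Finset.sum_congr rfl fun i _ => ?_
    simp [hA, transpose_mul, mul_assoc]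
  have hHh : H.IsHermitian := by
    unfold IsHermitian; rw [conjTranspose_eq_transpose_of_trivial, hH]
  obtain ⟨c, hc0, hc⟩ := exists_bound hHh
  choose K hK using fun i => step hH hc (hO i) (a i)
  have hL : 0 < Real.log 2 ^ 2 := by have := Real.log_pos (one_lt_two); positivity
  have base : ∀ i, rdist (g * gᵀ) (p i) ^ 2 = (∑ j, a i j ^ 2) / Real.log 2 ^ 2 := by
    intro i
    have hs := sum_eig (hO i) (ef_posDef (hO i) (a i) 1).1 (y := fun j => Real.exp (1 * a i j)) rfl
      (fun s => Real.log s ^ 2)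
    rw [hp, rd_conj hg (ef_posDef (hO i) (a i) 1), hs]
    simp
  have main : ∀ t : ℝ, 0 < t → t ≤ 1 → 4 * t * c ≤ 1 →
      4 * t * (H * H).trace ≤ t ^ 2 * ∑ i, ω i * K i := by
    intro t ht ht1 htc
    have hRu := R_unit hH hc ht.le htc
    have hR : (1 - t • H)ᵀ = 1 - t • H := by simp [hH]
    have hKt := fun i => hK i t ht ht1 htc
    set R := 1 - t • H with hRdef
    have hRd : IsUnit R.det := (isUnit_iff_isUnit_det _).1 hRu
    have hRi : IsUnit R⁻¹ := by
      rw [isUnit_iff_isUnit_det]; exact isUnit_nonsing_inv_det _ hRd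
    have hh : IsUnit (g * R⁻¹) := hg.mul hRi
    have hRiT : (R⁻¹)ᵀ = R⁻¹ := by rw [transpose_nonsing_inv, hR]
    have hS : ∀ i, (R * ef (O i) (a i) 1 * R).PosDef := by
      intro i
      have := posDef_conj' (ef_posDef (hO i) (a i) 1) hRu
      rwa [hR] at this
    have hpi : ∀ i, p i = (g * R⁻¹) * (R * ef (O i) (a i) 1 * R) * (g * R⁻¹)ᵀ := by
      intro i
      rw [hp, transpose_mul, hRiT]
      calc _ = g * 1 * ef (O i) (a i) 1 * 1 * gᵀ := by simp
        _ = _ := by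
          nth_rewrite 1 [← nonsing_inv_mul _ hRd]
          rw [← mul_nonsing_inv _ hRd]
          simp only [mul_assoc]
    have hq : ((g * R⁻¹) * (g * R⁻¹)ᵀ).PosDef := by
      have := posDef_conj' (PosDef.one (n := Fin n) (R := ℝ)) hh
      rwa [mul_one] at this
    have h1 := hmin _ hq
    have h2 : ∀ i, rdist ((g * R⁻¹) * (g * R⁻¹)ᵀ) (p i) ^ 2 ≤
        (∑ j, a i j ^ 2 - 4 * t * (A i * H).trace + t ^ 2 * K i) / Real.log 2 ^ 2 := by
      intro i
      conv_lhs => rw [hpi i]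
      rw [rd_conj hh (hS i)]
      exact div_le_div_of_nonneg_right (hKt i (hS i).1) hL.le
    have h3 : ∑ i, ω i * ((∑ j, a i j ^ 2) / Real.log 2 ^ 2) ≤
        ∑ i, ω i * ((∑ j, a i j ^ 2 - 4 * t * (A i * H).trace + t ^ 2 * K i) / Real.log 2 ^ 2) := by
      calc _ = ∑ i, ω i * (rdist (g * gᵀ) (p i)) ^ 2 := by simp only [base]
        _ ≤ _ := h1
        _ ≤ _ := Finset.sum_le_sum fun i _ => mul_le_mul_of_nonneg_left (h2 i) (hω i)
    simp only [← mul_div_assoc, ← Finset.sum_div] at h3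
    rw [div_le_div_iff_of_pos_right hL] at h3
    have e : (H * H).trace = ∑ i, ω i * (A i * H).trace := by
      conv_lhs => rw [hHdef]
      rw [Finset.sum_mul, trace_sum]
      refine Finset.sum_congr rfl fun i _ => ?_
      rw [← hHdef, smul_mul_assoc, trace_smul, smul_eq_mul]
    have e2 : ∑ i, ω i * (∑ j, a i j ^ 2 - 4 * t * (A i * H).trace + t ^ 2 * K i) =
        ∑ i, ω i * ∑ j, a i j ^ 2 - 4 * t * (H * H).trace + t ^ 2 * ∑ i, ω i * K i := by
      rw [e, Finset.mul_sum, Finset.mul_sum, ← Finset.sum_sub_distrib, ← Finset.sum_add_distrib]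
      exact Finset.sum_congr rfl fun i _ => by ring
    rw [e2] at h3
    linarith
  set τ := (H * H).trace with hτ
  set L := ∑ i, ω i * K i
  have hτ0 : τ ≤ 0 := by
    by_contra hcon
    push Not at hcon
    set t := min (1 / (1 + 4 * c)) (2 * τ / (|L| + 1)) with ht
    have hLp : 0 < |L| + 1 := by positivity
    have ht0 : 0 < t := lt_min (by positivity) (by positivity)
    have hta : t ≤ 1 / (1 + 4 * c) := min_le_left _ _
    have htb : t ≤ 2 * τ / (|L| + 1) := min_le_right _ _
    rw [le_div_iff₀ (by positivity)] at hta htb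
    have := main t ht0 (by nlinarith) (by nlinarith)
    have h5 : 4 * τ ≤ t * L := by
      have e : t * (4 * τ) ≤ t * (t * L) := by nlinarith
      exact le_of_mul_le_mul_left e ht0
    have h6 : t * L ≤ t * |L| := mul_le_mul_of_nonneg_left (le_abs_self _) ht0.le
    nlinarith
  have hτ1 : 0 ≤ τ := by
    have := (posSemidef_conjTranspose_mul_self H).trace_nonneg
    rwa [conjTranspose_eq_transpose_of_trivial, hH] at this
  have : (Hᴴ * H).trace = 0 := by
    rw [conjTranspose_eq_transpose_of_trivial, hH]; exact le_antisymm hτ0 hτ1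
  exact trace_conjTranspose_mul_self_eq_zero_iff.1 this

/-! ### The main inequality -/

lemma exists_ef {P : Matrix (Fin n) (Fin n) ℝ} (hP : P.PosDef) :
    ∃ (O : Matrix (Fin n) (Fin n) ℝ) (a : Fin n → ℝ), Oᵀ * O = 1 ∧ P = ef O a 1 := by
  obtain ⟨O, hO, _, h⟩ := spec_desc hP.1
  refine ⟨O, fun i => Real.log (eigsDesc P i), hO, ?_⟩
  unfold ef
  have : (fun i => Real.exp (1 * Real.log (eigsDesc P i))) = eigsDesc P := by
    ext i
    rw [one_mul, Real.exp_log (eigsDesc_pos hP i)]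
  rw [this]
  exact h

lemma exists_ef' {g p : Matrix (Fin n) (Fin n) ℝ} (hg : IsUnit g) (hp : p.PosDef) :
    ∃ (O : Matrix (Fin n) (Fin n) ℝ) (a : Fin n → ℝ), Oᵀ * O = 1 ∧ p = g * ef O a 1 * gᵀ := by
  have hd : IsUnit g.det := (isUnit_iff_isUnit_det _).1 hg
  have hd' : IsUnit gᵀ.det := by rwa [det_transpose]
  have hgi : IsUnit g⁻¹ := by
    rw [isUnit_iff_isUnit_det]; exact isUnit_nonsing_inv_det _ hd
  obtain ⟨O, a, hO, h⟩ := exists_ef (posDef_conj' hp hgi)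
  refine ⟨O, a, hO, ?_⟩
  rw [← h, transpose_nonsing_inv]
  calc p = (g * g⁻¹) * p * (gᵀ⁻¹ * gᵀ) := by
        rw [mul_nonsing_inv _ hd, nonsing_inv_mul _ hd', one_mul, mul_one]
    _ = _ := by simp only [mul_assoc]

lemma psum_eq {k : ℕ} (h : k ≤ n) (ξ : Fin n → ℝ) :
    psum ξ k = ∑ j : Fin k, ξ (Fin.castLE h j) := by
  unfold psum
  symm
  refine Finset.sum_bij (fun j _ => Fin.castLE h j) ?_ ?_ ?_ ?_
  · intro j _; simp
  · intro i _ j _ hij; exact Fin.castLE_injective h hij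
  · intro i hi
    rw [Finset.mem_filter] at hi
    exact ⟨⟨i, hi.2⟩, Finset.mem_univ _, rfl⟩
  · intro j _; rfl

lemma psum_vecd {p q S : Matrix (Fin n) (Fin n) ℝ} (hp : p.PosDef) (hq : q.PosDef) (hS : S.PosDef)
    (hc : S.charpoly = (p⁻¹ * q).charpoly) {k : ℕ} (h : k ≤ n) :
    psum (vecd p q) k = Real.log (topk h S) / Real.log 2 := by
  rw [psum_eq h, topk, Real.log_prod (fun i _ => (eigsDesc_pos hS _).ne'), Finset.sum_div]
  exact Finset.sum_congr rfl fun j _ => vecd_eq hp hq hS hc _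

lemma main_ineq {m : ℕ} {ω : Fin m → ℝ} (hω0 : ∀ i, 0 ≤ ω i) (hω1 : ∑ i, ω i = 1)
    {p p' : Fin m → Matrix (Fin n) (Fin n) ℝ}
    (hp : ∀ i, (p i).PosDef) (hp' : ∀ i, (p' i).PosDef)
    {u v : Matrix (Fin n) (Fin n) ℝ} (hu : u.PosDef) (hv : v.PosDef)
    (hubar : ∀ q : Matrix (Fin n) (Fin n) ℝ, q.PosDef →
      ∑ i, ω i * (rdist u (p i)) ^ 2 ≤ ∑ i, ω i * (rdist q (p i)) ^ 2)
    (hvbar : ∀ q : Matrix (Fin n) (Fin n) ℝ, q.PosDef →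
      ∑ i, ω i * (rdist v (p' i)) ^ 2 ≤ ∑ i, ω i * (rdist q (p' i)) ^ 2)
    {k : ℕ} (h : k ≤ n) :
    psum (vecd u v) k ≤ ∑ i, ω i * psum (vecd (p i) (p' i)) k := by
  set s := mpow u (1/2) with hs
  set si := mpow u (-(1/2)) with hsi
  have hsu : IsUnit s := IsUnit.of_mul_eq_one _ (sqrt_isqrt hu)
  have hsiu : IsUnit si := IsUnit.of_mul_eq_one _ (isqrt_sqrt hu)
  have hsT : sᵀ = s := mpow_symm hu _
  have hM : (si * v * si).PosDef := by
    have := posDef_conj' hv hsiu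
    rwa [mpow_symm hu] at this
  obtain ⟨U, hU, hU', hMU⟩ := spec_desc hM.1
  set l := eigsDesc (si * v * si) with hl
  have hlpos : ∀ i, 0 < l i := eigsDesc_pos hM
  have hlanti : Antitone l := eigsDesc_antitone _
  have hUu : IsUnit U := IsUnit.of_mul_eq_one _ hU'
  set g := s * U with hg
  have hgu : IsUnit g := hsu.mul hUu
  set D := diagonal (fun i => √(l i)) with hD
  have hDT : Dᵀ = D := diagonal_transpose _
  have hgDu : IsUnit (g * D) := hgu.mul (sqd_unit hlpos)
  have hug : u = g * gᵀ := by
    rw [hg, transpose_mul, hsT]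
    calc u = s * s := (sqrt_sq hu).symm
      _ = s * (U * Uᵀ) * s := by rw [hU', mul_one]
      _ = _ := by simp only [mul_assoc]
  have hvg : v = (g * D) * (g * D)ᵀ := by
    rw [transpose_mul, hDT, hg, transpose_mul, hsT]
    calc v = (s * si) * v * (si * s) := by rw [sqrt_isqrt hu, isqrt_sqrt hu, one_mul, mul_one]
      _ = s * (si * v * si) * s := by simp only [mul_assoc]
      _ = s * (U * (D * D) * Uᵀ) * s := by rw [hD, sqd_sq hlpos, ← hMU]
      _ = _ := by simp only [mul_assoc]
  choose O a hO hpe using fun i => exists_ef' hgu (hp i)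
  choose Q b hQ hpe' using fun i => exists_ef' hgDu (hp' i)
  have hkA := karcher hω0 hgu hO hpe (by rw [← hug]; exact hubar)
  have hkB := karcher hω0 hgDu hQ hpe' (by rw [← hvg]; exact hvbar)
  have hlog2 : 0 < Real.log 2 := Real.log_pos one_lt_two
  have hcM : (si * v * si).charpoly = (u⁻¹ * v).charpoly := by
    rw [charpoly_mul_comm, ← mul_assoc, hsi, isqrt_sq hu]
  have hcS : ∀ i, (Sc (O i) (Q i) (a i) (b i) l 1).charpoly = ((p i)⁻¹ * p' i).charpoly := by
    intro i
    have e1 : p' i = g * (D * ef (Q i) (b i) 1 * D) * gᵀ := by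
      rw [hpe' i, transpose_mul, hDT]; simp only [mul_assoc]
    have e2 : (ef (O i) (a i) 1)⁻¹ = ef (O i) (a i) (-(1/2)) * ef (O i) (a i) (-(1/2)) := by
      apply Matrix.inv_eq_left_inv
      rw [ef_add (hO i), ef_add (hO i)]
      have : (-(1/2) + -(1/2) + 1 : ℝ) = 0 := by norm_num
      rw [this, ef_zero (mul_eq_one_comm.1 (hO i))]
    rw [hpe i, e1, charpoly_conj hgu, e2, mul_assoc, charpoly_mul_comm]
    unfold Sc
    rw [mul_one, mul_one, ← hD, mul_assoc, charpoly_mul_comm]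
  have hu1 : psum (vecd u v) k = (∑ j : Fin k, Real.log (l (Fin.castLE h j))) / Real.log 2 := by
    rw [psum_vecd hu hv hM hcM h, topk, Real.log_prod (fun i _ => (eigsDesc_pos hM _).ne')]
  have hk := fun i => key (a := a i) (b := b i) h (hO i) (hQ i) hlpos hlanti
  have hsum : ∑ i, ω i * (∑ j : Fin k, Real.log (l (Fin.castLE h j)) +
      ∑ j : Fin k, ((Q i * diagonal (b i) * (Q i)ᵀ) (Fin.castLE h j) (Fin.castLE h j) -
        (O i * diagonal (a i) * (O i)ᵀ) (Fin.castLE h j) (Fin.castLE h j))) =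
      ∑ j : Fin k, Real.log (l (Fin.castLE h j)) := by
    simp only [mul_add, Finset.sum_add_distrib, ← Finset.sum_mul, hω1, one_mul]
    rw [add_eq_left]
    simp only [Finset.mul_sum]
    rw [Finset.sum_comm]
    apply Finset.sum_eq_zero
    intro j _
    have h1 := congrFun (congrFun hkA (Fin.castLE h j)) (Fin.castLE h j)
    have h2 := congrFun (congrFun hkB (Fin.castLE h j)) (Fin.castLE h j)
    simp only [Matrix.sum_apply, Matrix.smul_apply, smul_eq_mul, Matrix.zero_apply] at h1 h2
    simp only [mul_sub, Finset.sum_sub_distrib]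
    rw [h1, h2, sub_zero]
  rw [hu1, ← hsum, Finset.sum_div]
  refine Finset.sum_le_sum fun i _ => ?_
  rw [psum_vecd (hp i) (hp' i) (Sc_posDef (hO i) (hQ i) hlpos 1) (hcS i) h, mul_div_assoc]
  exact mul_le_mul_of_nonneg_left (div_le_div_of_nonneg_right (hk i) hlog2.le) (hω0 i)

lemma charpoly_det_eq {A B : Matrix (Fin n) (Fin n) ℝ} (h : A.charpoly = B.charpoly) :
    A.det = B.det := by
  rw [det_eq_sign_charpoly_coeff, det_eq_sign_charpoly_coeff, h]

lemma exists_S {p q : Matrix (Fin n) (Fin n) ℝ} (hp : p.PosDef) (hq : q.PosDef) :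
    ∃ S : Matrix (Fin n) (Fin n) ℝ, S.PosDef ∧ S.charpoly = (p⁻¹ * q).charpoly := by
  refine ⟨mpow p (-(1/2)) * q * mpow p (-(1/2)), ?_, ?_⟩
  · have := posDef_conj' hq (IsUnit.of_mul_eq_one _ (isqrt_sqrt hp))
    rwa [mpow_symm hp] at this
  · rw [charpoly_mul_comm, ← mul_assoc, isqrt_sq hp]

lemma psum_vecd_full {p q : Matrix (Fin n) (Fin n) ℝ} (hp : p.PosDef) (hq : q.PosDef) :
    psum (vecd p q) n = (Real.log q.det - Real.log p.det) / Real.log 2 := by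
  obtain ⟨S, hS, hc⟩ := exists_S hp hq
  rw [psum_vecd hp hq hS hc le_rfl]
  have h1 : topk le_rfl S = S.det := by
    obtain ⟨O, hO, hO', h⟩ := spec_desc hS.1
    have e : S.det = (diagonal (eigsDesc S)).det := by
      conv_lhs => rw [h]
      rw [det_mul_comm, ← mul_assoc, hO, one_mul]
    rw [e, det_diagonal]
    rfl
  rw [h1, charpoly_det_eq hc, det_mul, det_nonsing_inv, Ring.inverse_eq_inv',
    Real.log_mul (inv_ne_zero hp.det_pos.ne') hq.det_pos.ne', Real.log_inv]
  congr 1; ring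

lemma vecd_self {p : Matrix (Fin n) (Fin n) ℝ} (hp : p.PosDef) (i : Fin n) : vecd p p i = 0 := by
  have h1 : (1 : Matrix (Fin n) (Fin n) ℝ).PosDef := PosDef.one
  rw [vecd_eq hp hp h1 (by rw [nonsing_inv_mul _ ((isUnit_iff_isUnit_det _).1 hp.isUnit)])]
  have : eigsDesc (1 : Matrix (Fin n) (Fin n) ℝ) i = 1 := by
    obtain ⟨O, hO, hO', h⟩ := spec_desc h1.1
    have : diagonal (eigsDesc (1 : Matrix (Fin n) (Fin n) ℝ)) = 1 := by
      calc _ = (Oᵀ * O) * diagonal (eigsDesc (1 : Matrix (Fin n) (Fin n) ℝ)) * (Oᵀ * O) := by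
            rw [hO, one_mul, mul_one]
        _ = Oᵀ * (O * diagonal (eigsDesc (1 : Matrix (Fin n) (Fin n) ℝ)) * Oᵀ) * O := by
            simp only [mul_assoc]
        _ = 1 := by rw [← h, mul_one, hO]
    have := congrFun (congrFun this i) i
    rwa [diagonal_apply_eq, one_apply_eq] at this
  rw [this, Real.logb_one]

/-- Lipschitz property of the weighted barycenter in its last argument:
if `u = bar(ω; p₁,…,pₘ)` and `v = bar(ω; p₁,…,p_{m−1},pₘ′)` (characterized as minimizers of
the weighted sum of squared trace-metric distances over positive definite matrices), then
`d⃗(u,v) ⪯ ωₘ d⃗(pₘ,pₘ′)`. -/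
theorem statement11 {n m : ℕ} (ω : Fin (m+1) → ℝ)
    (hω0 : ∀ i, 0 ≤ ω i) (hω1 : ∑ i, ω i = 1)
    (p p' : Fin (m+1) → Matrix (Fin n) (Fin n) ℝ)
    (hp : ∀ i, (p i).PosDef) (hp' : ∀ i, (p' i).PosDef)
    (hagree : ∀ i, i ≠ Fin.last m → p' i = p i)
    (u v : Matrix (Fin n) (Fin n) ℝ) (hu : u.PosDef) (hv : v.PosDef)
    (hubar : ∀ q : Matrix (Fin n) (Fin n) ℝ, q.PosDef →
      ∑ i, ω i * (rdist u (p i)) ^ 2 ≤ ∑ i, ω i * (rdist q (p i)) ^ 2)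
    (hvbar : ∀ q : Matrix (Fin n) (Fin n) ℝ, q.PosDef →
      ∑ i, ω i * (rdist v (p' i)) ^ 2 ≤ ∑ i, ω i * (rdist q (p' i)) ^ 2) :
    maj (vecd u v) (fun i => ω (Fin.last m) * vecd (p (Fin.last m)) (p' (Fin.last m)) i) := by
  have hlast : ∀ (r r' : Fin (m+1) → Matrix (Fin n) (Fin n) ℝ), (∀ i, (r i).PosDef) →
      (∀ i, i ≠ Fin.last m → r' i = r i) → ∀ k,
      ∑ i, ω i * psum (vecd (r i) (r' i)) k =
        ω (Fin.last m) * psum (vecd (r (Fin.last m)) (r' (Fin.last m))) k := by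
    intro r r' hr hag k
    apply Finset.sum_eq_single
    · intro i _ hi
      rw [hag i hi]
      apply mul_eq_zero_of_right
      exact Finset.sum_eq_zero fun j _ => vecd_self (hr i) j
    · simp
  have hscale : ∀ k, psum (fun i => ω (Fin.last m) * vecd (p (Fin.last m)) (p' (Fin.last m)) i) k =
      ω (Fin.last m) * psum (vecd (p (Fin.last m)) (p' (Fin.last m))) k := by
    intro k
    unfold psum
    rw [Finset.mul_sum]
  have hle : ∀ k, k ≤ n → psum (vecd u v) k ≤
      psum (fun i => ω (Fin.last m) * vecd (p (Fin.last m)) (p' (Fin.last m)) i) k := by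
    intro k hk
    rw [hscale, ← hlast p p' hp hagree k]
    exact main_ineq hω0 hω1 hp hp' hu hv hubar hvbar hk
  refine ⟨fun k hk => hle k hk.le, le_antisymm (hle n le_rfl) ?_⟩
  have h2 := main_ineq hω0 hω1 hp' hp hv hu hvbar hubar (le_refl n)
  rw [hlast p' p hp' (fun i hi => (hagree i hi).symm), psum_vecd_full hv hu,
    psum_vecd_full (hp' _) (hp _)] at h2
  rw [hscale, psum_vecd_full hu hv, psum_vecd_full (hp _) (hp' _)]
  have e1 : ∀ x y : ℝ, (x - y) / Real.log 2 = -((y - x) / Real.log 2) := fun x y => by ring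
  rw [e1 (Real.log u.det), e1 (Real.log (p (Fin.last m)).det)] at h2
  linarith
end
end
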